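/- Assume hypotheses (H1)–(H3), let q0, q be chosen with 1 − 1/p < 1/q0 < min{β, δα, δ/p, 1/2} and 1/(q0·δ) ≤ 1/q < min{α, 1/p}, let ω : [0,T] → ℝ^m be continuous of finite p-variation, let 0 ≤ t0 < T and x_0 ∈ ℝ^d, and let x be the unique solution of finite q-variation of x_t = x_0 + ∫_{t0}^t f(s,x_s) ds + ∫_{t0}^t g(s,x_s) dω_s on [t0,T]. Then there exist positive constants C_1 = C_1(T) and C_2 = C_2(T), depending only on T and the constants in (H1)–(H3) (not on x_0 or ω), such that ‖x‖_{q-var,[t0,T]} ≤ C_1 [1 + (T − t0)^α] (1 + |x_0|) (1 + |||ω|||_{p-var,[t0,T]}) · exp( C_2 |||ω|||^{p'}_{p-var,[t0,T]} ), where p' := max{p, 1/α}. -/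

import Mathlib

open scoped BigOperators
open Set

noncomputable section

/-- Euclidean space `ℝ^n`. -/
abbrev Ed (n : ℕ) : Type := EuclideanSpace ℝ (Fin n)

section PVarDefs

variable {E F : Type*} [NormedAddCommGroup E] [NormedSpace ℝ E]
  [NormedAddCommGroup F] [NormedSpace ℝ F]

/-- The set of sums `Σ_i ‖x (t (i+1)) - x (t i)‖ ^ p` over all finite partitions
`a = t 0 < t 1 < ⋯ < t n = b` of `[a,b]`. -/
def pVarSums (p : ℝ) (x : ℝ → E) (a b : ℝ) : Set ℝ :=
  { v | ∃ n : ℕ, ∃ t : Fin (n + 1) → ℝ, StrictMono t ∧ t 0 = a ∧ t (Fin.last n) = b ∧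
      v = ∑ i : Fin n, ‖x (t i.succ) - x (t i.castSucc)‖ ^ p }

/-- The `p`-variation seminorm `|||x|||_{p-var,[a,b]}`. -/
def pVar (p : ℝ) (x : ℝ → E) (a b : ℝ) : ℝ :=
  sSup (pVarSums p x a b) ^ (1 / p)

/-- `x` is of finite `p`-variation on `[a,b]`. -/
def FinitePVar (p : ℝ) (x : ℝ → E) (a b : ℝ) : Prop :=
  BddAbove (pVarSums p x a b)

/-- The `p`-variation norm `‖x‖_{p-var,[a,b]} = ‖x a‖ + |||x|||_{p-var,[a,b]}`. -/
def pVarNorm (p : ℝ) (x : ℝ → E) (a b : ℝ) : ℝ :=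
  ‖x a‖ + pVar p x a b

/-- A control function on `[a,b]`: continuous on the simplex, vanishing on the diagonal,
superadditive and nonnegative. -/
def IsControlOn (a b : ℝ) (w : ℝ → ℝ → ℝ) : Prop :=
  ContinuousOn (fun pr : ℝ × ℝ => w pr.1 pr.2) {pr : ℝ × ℝ | a ≤ pr.1 ∧ pr.1 ≤ pr.2 ∧ pr.2 ≤ b} ∧
  (∀ t : ℝ, a ≤ t → t ≤ b → w t t = 0) ∧
  (∀ s t u : ℝ, a ≤ s → s ≤ t → t ≤ u → u ≤ b → w s t + w t u ≤ w s u) ∧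
  (∀ s t : ℝ, a ≤ s → s ≤ t → t ≤ b → 0 ≤ w s t)

/-- A tagged partition `a = t 0 < t 1 < ⋯ < t n = b` of `[a,b]`, with tags
`tag i ∈ [t i, t (i+1)]`. -/
structure TaggedPartition (a b : ℝ) where
  n : ℕ
  t : Fin (n + 1) → ℝ
  tag : Fin n → ℝ
  mono : StrictMono t
  first : t 0 = a
  last : t (Fin.last n) = b
  tag_mem : ∀ i : Fin n, tag i ∈ Set.Icc (t i.castSucc) (t i.succ)

/-- The mesh of a tagged partition. -/
def TaggedPartition.mesh {a b : ℝ} (P : TaggedPartition a b) : ℝ :=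
  ⨆ i : Fin P.n, (P.t i.succ - P.t i.castSucc)

/-- Riemann–Stieltjes sum of `x` against `ω` along a tagged partition. -/
def RSSum (x : ℝ → E →L[ℝ] F) (ω : ℝ → E) {a b : ℝ} (P : TaggedPartition a b) : F :=
  ∑ i : Fin P.n, x (P.tag i) (ω (P.t i.succ) - ω (P.t i.castSucc))

/-- `v` is the Young integral `∫_a^b x dω`: the Riemann–Stieltjes sums converge to `v`
as the mesh tends to `0`. -/
def IsYoungIntegral (x : ℝ → E →L[ℝ] F) (ω : ℝ → E) (a b : ℝ) (v : F) : Prop :=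
  ∀ ε : ℝ, 0 < ε → ∃ δ : ℝ, 0 < δ ∧
    ∀ P : TaggedPartition a b, P.mesh < δ → ‖RSSum x ω P - v‖ < ε

/-- The Young integral `∫_a^b x dω` (an arbitrary value, `0`, if the limit does not exist). -/
def youngIntegral (x : ℝ → E →L[ℝ] F) (ω : ℝ → E) (a b : ℝ) : F :=
  letI := Classical.propDecidable (∃ v, IsYoungIntegral x ω a b v)
  if hv : ∃ v, IsYoungIntegral x ω a b v then hv.choose else 0

end PVarDefs

/-- `x` is a solution on `[t0,T1]` of the Young differential equation
`x t = x0 + ∫_{t0}^t f(s, x s) ds + ∫_{t0}^t g(s, x s) dω_s`, in the space of continuous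
paths of finite `q`-variation. -/
def IsSolutionOn {d m : ℕ} (f : ℝ → Ed d → Ed d) (g : ℝ → Ed d → (Ed m →L[ℝ] Ed d))
    (ω : ℝ → Ed m) (q t0 T1 : ℝ) (x0 : Ed d) (x : ℝ → Ed d) : Prop :=
  ContinuousOn x (Set.Icc t0 T1) ∧ FinitePVar q x t0 T1 ∧ x t0 = x0 ∧
    ∀ t ∈ Set.Icc t0 T1,
      x t = x0 + (∫ s in t0..t, f s (x s)) + youngIntegral (fun s => g s (x s)) ω t0 t


/-- A nonnegative superadditive function of subintervals of `[a,b]`; continuity is not assumed. -/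
def SuperAddOn (a b : ℝ) (w : ℝ → ℝ → ℝ) : Prop :=
  (∀ s t : ℝ, a ≤ s → s ≤ t → t ≤ b → 0 ≤ w s t) ∧
  (∀ s t u : ℝ, a ≤ s → s ≤ t → t ≤ u → u ≤ b → w s t + w t u ≤ w s u)

namespace SuperAddOn

variable {a b : ℝ} {w w' : ℝ → ℝ → ℝ}

lemma mono (hw : SuperAddOn a b w) {s s' t' t : ℝ} (h1 : a ≤ s) (h2 : s ≤ s') (h3 : s' ≤ t')
    (h4 : t' ≤ t) (h5 : t ≤ b) : w s' t' ≤ w s t := by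
  have e1 := hw.2 s s' t h1 h2 (h3.trans h4) h5
  have e2 := hw.2 s' t' t (h1.trans h2) h3 h4 h5
  have e3 := hw.1 s s' h1 h2 (by linarith)
  have e4 := hw.1 t' t (by linarith) h4 h5
  linarith

lemma restrict (hw : SuperAddOn a b w) {a' b' : ℝ} (h1 : a ≤ a') (h2 : b' ≤ b) :
    SuperAddOn a' b' w :=
  ⟨fun s t hs ht hb => hw.1 s t (h1.trans hs) ht (hb.trans h2),
    fun s t u hs ht hu hb => hw.2 s t u (h1.trans hs) ht hu (hb.trans h2)⟩

lemma add (hw : SuperAddOn a b w) (hw' : SuperAddOn a b w') :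
    SuperAddOn a b (fun s t => w s t + w' s t) := by
  refine ⟨fun s t h1 h2 h3 => add_nonneg (hw.1 s t h1 h2 h3) (hw'.1 s t h1 h2 h3), ?_⟩
  intro s t u h1 h2 h3 h4
  have := hw.2 s t u h1 h2 h3 h4
  have := hw'.2 s t u h1 h2 h3 h4
  dsimp only
  linarith

lemma div_const (hw : SuperAddOn a b w) {c : ℝ} (hc : 0 ≤ c) :
    SuperAddOn a b (fun s t => w s t / c) := by
  refine ⟨fun s t h1 h2 h3 => div_nonneg (hw.1 s t h1 h2 h3) hc, ?_⟩
  intro s t u h1 h2 h3 h4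
  have := hw.2 s t u h1 h2 h3 h4
  dsimp only
  rw [← add_div]
  gcongr

lemma sum_le (hw : SuperAddOn a b w) {t : ℕ → ℝ} (ht : Monotone t) (n : ℕ) (ha : a ≤ t 0)
    (hb : t n ≤ b) : ∑ k ∈ Finset.range n, w (t k) (t (k + 1)) ≤ w (t 0) (t n) := by
  induction n with
  | zero => simpa using hw.1 (t 0) (t 0) ha le_rfl hb
  | succ n ih =>
    have e : t n ≤ t (n + 1) := ht (Nat.le_succ n)
    rw [Finset.sum_range_succ]
    have := ih (e.trans hb)
    have := hw.2 (t 0) (t n) (t (n + 1)) ha (ht (Nat.zero_le n)) e hb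
    linarith

lemma sum_rpow_le (hw : SuperAddOn a b w) {t : ℕ → ℝ} (ht : Monotone t) (n : ℕ) (ha : a ≤ t 0)
    (hb : t n ≤ b) {θ : ℝ} (hθ : 1 ≤ θ) :
    ∑ k ∈ Finset.range n, w (t k) (t (k + 1)) ^ θ ≤ w (t 0) (t n) ^ θ := by
  have h0 : 0 ≤ w (t 0) (t n) := hw.1 _ _ ha (ht (Nat.zero_le n)) hb
  have split : ∀ r : ℝ, 0 ≤ r → r ^ θ = r ^ (θ - 1) * r := by
    intro r hr
    rcases hr.eq_or_lt with rfl | hr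
    · rw [Real.zero_rpow (by linarith), mul_zero]
    · rw [Real.rpow_sub_one hr.ne', div_mul_cancel₀ _ hr.ne']
  calc ∑ k ∈ Finset.range n, w (t k) (t (k + 1)) ^ θ
      ≤ ∑ k ∈ Finset.range n, w (t 0) (t n) ^ (θ - 1) * w (t k) (t (k + 1)) := by
        refine Finset.sum_le_sum fun k hk => ?_
        have hk' : k + 1 ≤ n := Finset.mem_range.1 hk
        have e0 : t 0 ≤ t k := ht (Nat.zero_le k)
        have e1 : t k ≤ t (k + 1) := ht (Nat.le_succ k)
        have e2 : t (k + 1) ≤ t n := ht hk'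
        have e3 := hw.1 (t k) (t (k + 1)) (ha.trans e0) e1 (e2.trans hb)
        rw [split _ e3]
        gcongr
        exact hw.mono ha e0 e1 e2 hb
    _ = w (t 0) (t n) ^ (θ - 1) * ∑ k ∈ Finset.range n, w (t k) (t (k + 1)) := by
        rw [Finset.mul_sum]
    _ ≤ w (t 0) (t n) ^ (θ - 1) * w (t 0) (t n) := by
        gcongr
        exact hw.sum_le ht n ha hb
    _ = _ := (split _ h0).symm

end SuperAddOn

lemma superAddOn_sub (a b : ℝ) : SuperAddOn a b (fun s t => t - s) :=
  ⟨fun s t _ h _ => sub_nonneg.2 h, fun s t u _ _ _ _ => by dsimp only; linarith⟩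

lemma IsControlOn.superAddOn {a b : ℝ} {w : ℝ → ℝ → ℝ} (hw : IsControlOn a b w) :
    SuperAddOn a b w :=
  ⟨hw.2.2.2, hw.2.2.1⟩

/-- The extension of a finite sequence to `ℕ` by its last value. -/
def extendFin {n : ℕ} (t : Fin (n + 1) → ℝ) (k : ℕ) : ℝ := t ⟨min k n, by omega⟩

lemma extendFin_monotone {n : ℕ} {t : Fin (n + 1) → ℝ} (ht : StrictMono t) :
    Monotone (extendFin t) := fun i j hij =>
  ht.monotone (by rw [Fin.mk_le_mk]; omega)

lemma extendFin_zero {n : ℕ} (t : Fin (n + 1) → ℝ) : extendFin t 0 = t 0 := by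
  simp [extendFin]

lemma extendFin_last {n : ℕ} (t : Fin (n + 1) → ℝ) : extendFin t n = t (Fin.last n) := by
  simp [extendFin, Fin.last]

lemma sum_extendFin {M : Type*} [AddCommMonoid M] {n : ℕ} (t : Fin (n + 1) → ℝ)
    (φ : ℝ → ℝ → M) :
    ∑ i : Fin n, φ (t i.castSucc) (t i.succ) =
      ∑ k ∈ Finset.range n, φ (extendFin t k) (extendFin t (k + 1)) := by
  rw [Finset.sum_range]
  refine Finset.sum_congr rfl fun i _ => ?_
  have h1 : extendFin t i = t i.castSucc := by
    unfold extendFin; congr 1; ext; simp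
  have h2 : extendFin t (i + 1) = t i.succ := by
    unfold extendFin; congr 1; ext; simp
  rw [h1, h2]

section Variation

variable {E : Type*} [NormedAddCommGroup E]

lemma pVarSums_nonneg {p : ℝ} {x : ℝ → E} {a b v : ℝ} (hv : v ∈ pVarSums p x a b) : 0 ≤ v := by
  obtain ⟨n, t, -, -, -, rfl⟩ := hv
  exact Finset.sum_nonneg fun i _ => Real.rpow_nonneg (norm_nonneg _) _

lemma pVarSums_refl (p : ℝ) (x : ℝ → E) (a : ℝ) : (0 : ℝ) ∈ pVarSums p x a a :=
  ⟨0, fun _ => a, fun i j hij => absurd hij (by omega), rfl, rfl, by simp⟩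

lemma pVarSums_pair (p : ℝ) (x : ℝ → E) {a b : ℝ} (hab : a < b) :
    ‖x b - x a‖ ^ p ∈ pVarSums p x a b := by
  refine ⟨1, ![a, b], ?_, rfl, rfl, by simp⟩
  rw [Fin.strictMono_iff_lt_succ]
  intro i
  fin_cases i
  simpa using hab

lemma pVarSums_nonempty (p : ℝ) (x : ℝ → E) {a b : ℝ} (hab : a ≤ b) :
    (pVarSums p x a b).Nonempty := by
  rcases hab.eq_or_lt with rfl | h
  · exact ⟨_, pVarSums_refl p x a⟩
  · exact ⟨_, pVarSums_pair p x h⟩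

lemma pVarSums_iff {p : ℝ} {x : ℝ → E} {a b v : ℝ} :
    v ∈ pVarSums p x a b ↔ ∃ n : ℕ, ∃ t : ℕ → ℝ, (∀ k < n, t k < t (k + 1)) ∧ t 0 = a ∧ t n = b ∧
      v = ∑ k ∈ Finset.range n, ‖x (t (k + 1)) - x (t k)‖ ^ p := by
  constructor
  · rintro ⟨n, t, ht, h0, h1, rfl⟩
    refine ⟨n, extendFin t, fun k hk => ht ?_, by rw [extendFin_zero, h0],
      by rw [extendFin_last, h1], sum_extendFin t fun r s => ‖x s - x r‖ ^ p⟩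
    rw [Fin.mk_lt_mk]; omega
  · rintro ⟨n, t, ht, h0, h1, rfl⟩
    refine ⟨n, fun i => t i, ?_, h0, h1, ?_⟩
    · rw [Fin.strictMono_iff_lt_succ]
      intro i
      exact ht i i.2
    · rw [Finset.sum_range]; rfl

lemma pVarSums_concat {p : ℝ} {x : ℝ → E} {a b c v v' : ℝ} (hv : v ∈ pVarSums p x a b)
    (hv' : v' ∈ pVarSums p x b c) : v + v' ∈ pVarSums p x a c := by
  rw [pVarSums_iff] at *
  obtain ⟨n, t, ht, h0, h1, rfl⟩ := hv
  obtain ⟨n', t', ht', h0', h1', rfl⟩ := hv'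
  have key : ∀ k, (if n + k ≤ n then t (n + k) else t' (n + k - n)) = t' k := by
    intro k
    rcases Nat.eq_zero_or_pos k with rfl | hk
    · simp [h0', h1]
    · rw [if_neg (by omega)]; congr 1; omega
  have key' : ∀ k ≤ n, (if k ≤ n then t k else t' (k - n)) = t k := fun k hk => if_pos hk
  refine ⟨n + n', fun k => if k ≤ n then t k else t' (k - n), ?_, ?_, ?_, ?_⟩
  · intro k hk
    rcases lt_or_ge k n with h | h
    · simpa only [key' k h.le, key' (k + 1) h] using ht k h
    · obtain ⟨j, rfl⟩ := Nat.exists_eq_add_of_le h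
      simpa only [add_assoc, key] using ht' j (by omega)
  · simp [h0]
  · simpa only [key] using h1'
  · rw [Finset.sum_range_add]
    congr 1
    · refine Finset.sum_congr rfl fun k hk => ?_
      have hk' := Finset.mem_range.1 hk
      simp only [key' k hk'.le, key' (k + 1) hk']
    · refine Finset.sum_congr rfl fun k hk => ?_
      simp only [add_assoc, key]

lemma FinitePVar.restrict {p : ℝ} {x : ℝ → E} {a b : ℝ} (hx : FinitePVar p x a b) {s t : ℝ}
    (hs : a ≤ s) (ht : t ≤ b) : FinitePVar p x s t := by
  obtain ⟨C, hC⟩ := hx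
  refine ⟨C, fun v hv => ?_⟩
  obtain ⟨v₁, h₁⟩ := pVarSums_nonempty p x hs
  obtain ⟨v₂, h₂⟩ := pVarSums_nonempty p x ht
  have := hC (pVarSums_concat (pVarSums_concat h₁ hv) h₂)
  have := pVarSums_nonneg h₁
  have := pVarSums_nonneg h₂
  linarith

lemma sSup_pVarSums_nonneg (p : ℝ) (x : ℝ → E) (a b : ℝ) : 0 ≤ sSup (pVarSums p x a b) :=
  Real.sSup_nonneg fun _ hv => pVarSums_nonneg hv

lemma FinitePVar.superAddOn {p : ℝ} {x : ℝ → E} {a b : ℝ} (hx : FinitePVar p x a b) :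
    SuperAddOn a b (fun s t => sSup (pVarSums p x s t)) := by
  refine ⟨fun s t _ _ _ => sSup_pVarSums_nonneg p x s t, ?_⟩
  intro s t u hs ht hu hb
  have hbdd := hx.restrict hs hb
  have e1 : ∀ v ∈ pVarSums p x s t, v + sSup (pVarSums p x t u) ≤ sSup (pVarSums p x s u) := by
    intro v hv
    rw [← le_sub_iff_add_le']
    refine csSup_le (pVarSums_nonempty p x hu) fun v' hv' => ?_
    rw [le_sub_iff_add_le']
    exact le_csSup hbdd (pVarSums_concat hv hv')
  dsimp only
  rw [← le_sub_iff_add_le]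
  refine csSup_le (pVarSums_nonempty p x ht) fun v hv => ?_
  rw [le_sub_iff_add_le]
  exact e1 v hv

lemma FinitePVar.rpow_le {p : ℝ} (hp : 0 < p) {x : ℝ → E} {a b : ℝ} (hx : FinitePVar p x a b)
    {s t : ℝ} (hs : a ≤ s) (hst : s ≤ t) (ht : t ≤ b) :
    ‖x t - x s‖ ^ p ≤ sSup (pVarSums p x s t) := by
  rcases hst.eq_or_lt with rfl | h
  · rw [sub_self, norm_zero, Real.zero_rpow hp.ne']
    exact sSup_pVarSums_nonneg p x s s
  · exact le_csSup (hx.restrict hs ht) (pVarSums_pair p x h)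

lemma FinitePVar.norm_le {p : ℝ} (hp : 0 < p) {x : ℝ → E} {a b : ℝ} (hx : FinitePVar p x a b)
    {s t : ℝ} (hs : a ≤ s) (hst : s ≤ t) (ht : t ≤ b) :
    ‖x t - x s‖ ≤ sSup (pVarSums p x s t) ^ (1 / p) := by
  have := Real.rpow_le_rpow (by positivity) (hx.rpow_le hp hs hst ht) (one_div_pos.2 hp).le
  rwa [← Real.rpow_mul (norm_nonneg _), mul_one_div_cancel hp.ne', Real.rpow_one] at this

end Variation

section Glue

variable {E : Type*} [NormedAddCommGroup E]

lemma pVar_nonneg (p : ℝ) (x : ℝ → E) (a b : ℝ) : 0 ≤ pVar p x a b :=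
  Real.rpow_nonneg (sSup_pVarSums_nonneg p x a b) _

lemma pVar_rpow {p : ℝ} (hp : 0 < p) (x : ℝ → E) (a b : ℝ) :
    pVar p x a b ^ p = sSup (pVarSums p x a b) := by
  unfold pVar
  rw [← Real.rpow_mul (sSup_pVarSums_nonneg p x a b), one_div_mul_cancel hp.ne', Real.rpow_one]

lemma pVar_le_of_sum_le {p : ℝ} (hp : 0 < p) {x : ℝ → E} {a b C : ℝ} (hab : a ≤ b) (hC : 0 ≤ C)
    (h : ∀ v ∈ pVarSums p x a b, v ≤ C ^ p) : pVar p x a b ≤ C := by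
  have h1 : sSup (pVarSums p x a b) ≤ C ^ p := csSup_le (pVarSums_nonempty p x hab) h
  have h2 := Real.rpow_le_rpow (sSup_pVarSums_nonneg p x a b) h1 (one_div_pos.2 hp).le
  rwa [← Real.rpow_mul hC, mul_one_div_cancel hp.ne', Real.rpow_one] at h2

lemma pVar_le_of_norm_le {p ν C : ℝ} (hp : 0 < p) (hν : 1 ≤ ν * p) (hC : 0 ≤ C) {x : ℝ → E}
    {a b : ℝ} (hab : a ≤ b) {w : ℝ → ℝ → ℝ} (hw : SuperAddOn a b w) (hw1 : w a b ≤ 1)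
    (h : ∀ u v, a ≤ u → u ≤ v → v ≤ b → ‖x v - x u‖ ≤ C * w u v ^ ν) :
    pVar p x a b ≤ C := by
  refine pVar_le_of_sum_le hp hab hC ?_
  rintro v ⟨n, t, ht, h0, h1, rfl⟩
  rw [sum_extendFin t fun r s => ‖x s - x r‖ ^ p]
  have hm := extendFin_monotone ht
  have h0' : extendFin t 0 = a := by rw [extendFin_zero, h0]
  have h1' : extendFin t n = b := by rw [extendFin_last, h1]
  calc ∑ k ∈ Finset.range n, ‖x (extendFin t (k + 1)) - x (extendFin t k)‖ ^ p
      ≤ ∑ k ∈ Finset.range n, C ^ p * w (extendFin t k) (extendFin t (k + 1)) ^ (ν * p) := by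
        refine Finset.sum_le_sum fun k hk => ?_
        have hk' : k + 1 ≤ n := Finset.mem_range.1 hk
        have e0 : a ≤ extendFin t k := h0' ▸ hm (Nat.zero_le k)
        have e1 : extendFin t k ≤ extendFin t (k + 1) := hm (Nat.le_succ k)
        have e2 : extendFin t (k + 1) ≤ b := h1' ▸ hm hk'
        have e3 := hw.1 _ _ e0 e1 e2
        rw [Real.rpow_mul e3, ← Real.mul_rpow hC (Real.rpow_nonneg e3 _)]
        exact Real.rpow_le_rpow (norm_nonneg _) (h _ _ e0 e1 e2) hp.le
    _ = C ^ p * ∑ k ∈ Finset.range n, w (extendFin t k) (extendFin t (k + 1)) ^ (ν * p) := by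
        rw [Finset.mul_sum]
    _ ≤ C ^ p * w (extendFin t 0) (extendFin t n) ^ (ν * p) := by
        gcongr
        exact hw.sum_rpow_le hm n h0'.ge h1'.le hν
    _ ≤ C ^ p * 1 := by
        rw [h0', h1']
        gcongr
        exact Real.rpow_le_one (hw.1 a b le_rfl hab le_rfl) hw1 (by linarith)
    _ = C ^ p := mul_one _

lemma pVar_le_add {p : ℝ} (hp : 1 ≤ p) {x : ℝ → E} {a b c : ℝ} (hx : FinitePVar p x a c)
    (hab : a ≤ b) (hbc : b ≤ c) : pVar p x a c ≤ pVar p x a b + pVar p x b c := by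
  have hp0 : 0 < p := by linarith
  refine pVar_le_of_sum_le hp0 (hab.trans hbc) (add_nonneg (pVar_nonneg _ _ _ _)
    (pVar_nonneg _ _ _ _)) ?_
  rintro v ⟨n, t, ht, h0, h1, rfl⟩
  rw [sum_extendFin t fun r s => ‖x s - x r‖ ^ p]
  have hm := extendFin_monotone ht
  have h0' : extendFin t 0 = a := by rw [extendFin_zero, h0]
  have h1' : extendFin t n = c := by rw [extendFin_last, h1]
  generalize extendFin t = τ at hm h0' h1'
  have key : ∀ (a' b' : ℝ) (σ : ℕ → ℝ), Monotone σ → a ≤ a' → b' ≤ c → σ 0 = a' → σ n = b' →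
      (∑ k ∈ Finset.range n, ‖x (σ (k + 1)) - x (σ k)‖ ^ p) ^ (1 / p) ≤ pVar p x a' b' := by
    intro a' b' σ hσ ha' hb' hσ0 hσn
    unfold pVar
    refine Real.rpow_le_rpow (Finset.sum_nonneg fun k _ => by positivity) ?_ (by positivity)
    have hx' := hx.restrict ha' hb'
    calc _ ≤ ∑ k ∈ Finset.range n, sSup (pVarSums p x (σ k) (σ (k + 1))) := by
          refine Finset.sum_le_sum fun k hk => ?_
          have hk' : k + 1 ≤ n := Finset.mem_range.1 hk
          exact hx'.rpow_le hp0 (hσ0 ▸ hσ (Nat.zero_le k)) (hσ (Nat.le_succ k)) (hσn ▸ hσ hk')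
      _ ≤ _ := by
          have := hx'.superAddOn.sum_le hσ n hσ0.ge hσn.le
          rwa [hσ0, hσn] at this
  have k1 := key a b (fun k => min (τ k) b) (fun i j hij => min_le_min_right _ (hm hij)) le_rfl
    hbc (by simp [h0', hab]) (by simp [h1', hbc])
  have k2 := key b c (fun k => max (τ k) b) (fun i j hij => max_le_max_right _ (hm hij)) hab
    le_rfl (by simp [h0', hab]) (by simp [h1', hbc])
  have hsplit : ∀ r, x r = x (min r b) + x (max r b) - x b := by
    intro r
    rcases le_total r b with h | h <;> simp [h]
  have hmink := Real.Lp_add_le (Finset.range n)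
    (fun k => ‖x (min (τ (k + 1)) b) - x (min (τ k) b)‖)
    (fun k => ‖x (max (τ (k + 1)) b) - x (max (τ k) b)‖) hp
  have hle : (∑ k ∈ Finset.range n, ‖x (τ (k + 1)) - x (τ k)‖ ^ p) ^ (1 / p) ≤
      pVar p x a b + pVar p x b c := by
    refine le_trans ?_ (hmink.trans ?_)
    · refine Real.rpow_le_rpow (Finset.sum_nonneg fun k _ => by positivity) ?_ (by positivity)
      refine Finset.sum_le_sum fun k _ => Real.rpow_le_rpow (norm_nonneg _) ?_ hp0.le
      rw [abs_of_nonneg (by positivity)]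
      refine le_trans (le_of_eq ?_) (norm_add_le _ _)
      rw [hsplit (τ (k + 1)), hsplit (τ k)]
      congr 1
      abel
    · simp only [abs_norm]
      exact add_le_add k1 k2
  have hs : 0 ≤ ∑ k ∈ Finset.range n, ‖x (τ (k + 1)) - x (τ k)‖ ^ p :=
    Finset.sum_nonneg fun k _ => by positivity
  have := Real.rpow_le_rpow (by positivity) hle hp0.le
  rwa [← Real.rpow_mul hs, one_div_mul_cancel hp0.ne', Real.rpow_one] at this

end Glue

lemma ContinuousOn.exists_osc_le {E : Type*} [NormedAddCommGroup E] {ω : ℝ → E} {a b : ℝ}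
    (hω : ContinuousOn ω (Set.Icc a b)) {o : ℝ} (ho : 0 < o) :
    ∃ ρ > 0, ∀ s t, a ≤ s → s ≤ t → t ≤ b → t - s ≤ ρ → ‖ω t - ω s‖ ≤ o := by
  have huc := isCompact_Icc.uniformContinuousOn_of_continuous hω
  rw [Metric.uniformContinuousOn_iff] at huc
  obtain ⟨ρ, hρ, h⟩ := huc o ho
  refine ⟨ρ / 2, half_pos hρ, fun s t hs hst ht hd => ?_⟩
  rw [← dist_eq_norm]
  refine (h t ⟨hs.trans hst, ht⟩ s ⟨hs, hst.trans ht⟩ ?_).le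
  rw [Real.dist_eq, abs_of_nonneg (by linarith)]
  linarith

section Sewing

variable {E F : Type*} [NormedAddCommGroup E] [NormedSpace ℝ E]
  [NormedAddCommGroup F] [NormedSpace ℝ F]

/-- The constant in the Young–Loève estimate. -/
def sewConst (θ : ℝ) : ℝ := 2 / (1 - 2 ^ (1 - θ))

lemma two_rpow_lt_one {θ : ℝ} (hθ : 1 < θ) : (2 : ℝ) ^ (1 - θ) < 1 :=
  Real.rpow_lt_one_of_one_lt_of_neg (by norm_num) (by linarith)

lemma sewConst_pos {θ : ℝ} (hθ : 1 < θ) : 0 < sewConst θ :=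
  div_pos (by norm_num) (by linarith [two_rpow_lt_one hθ])

lemma sewConst_eq {θ : ℝ} (hθ : 1 < θ) {r : ℝ} (hr : 0 ≤ r) :
    2 * (sewConst θ * (r / 2) ^ θ) + 2 * r ^ θ = sewConst θ * r ^ θ := by
  have h1 : (2 : ℝ) ^ (1 - θ) = 2 / 2 ^ θ := by
    rw [Real.rpow_sub (by norm_num), Real.rpow_one]
  have h2 := two_rpow_lt_one hθ
  have h3 : sewConst θ * (1 - 2 ^ (1 - θ)) = 2 := by
    unfold sewConst; exact div_mul_cancel₀ _ (by linarith)
  rw [Real.div_rpow hr (by norm_num)]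
  rw [h1] at h3
  have h4 : (0 : ℝ) < 2 ^ θ := by positivity
  linear_combination (-(r ^ θ)) * h3

lemma norm_sum_sub_le {a b θ D : ℝ} (hθ : 1 < θ) (hD : 0 ≤ D) {w : ℝ → ℝ → ℝ}
    (hw : SuperAddOn a b w) {y : ℝ → E →L[ℝ] F} {ω : ℝ → E}
    (hprod : ∀ s t u, a ≤ s → s ≤ t → t ≤ u → u ≤ b →
      ‖y t - y s‖ * ‖ω u - ω t‖ ≤ D * w s u ^ θ)
    {t : ℕ → ℝ} (ht : Monotone t) (i j : ℕ) (hij : i ≤ j) (ha : a ≤ t i) (hb : t j ≤ b) :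
    ‖∑ k ∈ Finset.Ico i j, y (t k) (ω (t (k + 1)) - ω (t k)) - y (t i) (ω (t j) - ω (t i))‖ ≤
      sewConst θ * D * w (t i) (t j) ^ θ := by
  induction hn : j - i using Nat.strong_induction_on generalizing i j with
  | _ n ih =>
  subst hn
  have hK := sewConst_pos hθ
  have hW0 := hw.1 _ _ ha (ht hij) hb
  have hdiag : ∀ s, a ≤ s → s ≤ b → w s s = 0 := fun s h1 h2 => by
    have := hw.2 s s s h1 le_rfl le_rfl h2
    have := hw.1 s s h1 le_rfl h2
    linarith
  rcases hij.eq_or_lt with rfl | hlt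
  · simp only [Finset.Ico_self, Finset.sum_empty, sub_self, map_zero, norm_zero]
    positivity
  classical
  have hex : ∃ m, i < m ∧ (m = j ∨ w (t i) (t j) / 2 < w (t i) (t m)) := ⟨j, hlt, Or.inl rfl⟩
  obtain ⟨him, hm⟩ := Nat.find_spec hex
  have hmin := fun k => @Nat.find_min _ _ hex k
  have hmj : Nat.find hex ≤ j := Nat.find_min' hex ⟨hlt, Or.inl rfl⟩
  generalize Nat.find hex = m at him hm hmin hmj
  obtain ⟨k, rfl⟩ : ∃ k, m = k + 1 := ⟨m - 1, by omega⟩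
  have hik : i ≤ k := by omega
  have tik := ht hik
  have tkm := ht (Nat.le_succ k)
  have tmj := ht hmj
  have hl : w (t i) (t k) ≤ w (t i) (t j) / 2 := by
    rcases hik.eq_or_lt with rfl | h
    · rw [hdiag _ ha ((ht hlt.le).trans hb)]; positivity
    · by_contra hcon
      exact hmin k (Nat.lt_succ_self k) ⟨h, Or.inr (not_le.1 hcon)⟩
  have hr : w (t (k + 1)) (t j) ≤ w (t i) (t j) / 2 := by
    rcases hm with h | h
    · rw [h, hdiag _ (ha.trans (ht hij)) hb]; positivity
    · have := hw.2 _ _ _ ha (tik.trans tkm) tmj hb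
      linarith
  have hkb : t k ≤ b := tkm.trans (tmj.trans hb)
  have hma : a ≤ t (k + 1) := ha.trans (tik.trans tkm)
  have e1 := ih (k - i) (by omega) i k hik ha hkb rfl
  have e2 := ih (j - (k + 1)) (by omega) (k + 1) j hmj hma hb rfl
  have e3 := hprod (t i) (t k) (t (k + 1)) ha tik tkm (tmj.trans hb)
  have e4 := hprod (t i) (t (k + 1)) (t j) ha (tik.trans tkm) tmj hb
  have e3' : w (t i) (t (k + 1)) ^ θ ≤ w (t i) (t j) ^ θ :=
    Real.rpow_le_rpow (hw.1 _ _ ha (tik.trans tkm) (tmj.trans hb))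
      (hw.mono ha le_rfl (tik.trans tkm) tmj hb) (by linarith)
  have e1' : w (t i) (t k) ^ θ ≤ (w (t i) (t j) / 2) ^ θ :=
    Real.rpow_le_rpow (hw.1 _ _ ha tik hkb) hl (by linarith)
  have e2' : w (t (k + 1)) (t j) ^ θ ≤ (w (t i) (t j) / 2) ^ θ :=
    Real.rpow_le_rpow (hw.1 _ _ hma tmj hb) hr (by linarith)
  have hdecomp : ∑ k ∈ Finset.Ico i j, y (t k) (ω (t (k + 1)) - ω (t k))
        - y (t i) (ω (t j) - ω (t i)) =
      (∑ l ∈ Finset.Ico i k, y (t l) (ω (t (l + 1)) - ω (t l)) - y (t i) (ω (t k) - ω (t i))) +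
      (∑ l ∈ Finset.Ico (k + 1) j, y (t l) (ω (t (l + 1)) - ω (t l))
        - y (t (k + 1)) (ω (t j) - ω (t (k + 1)))) +
      ((y (t k) - y (t i)) (ω (t (k + 1)) - ω (t k)) +
        (y (t (k + 1)) - y (t i)) (ω (t j) - ω (t (k + 1)))) := by
    rw [← Finset.sum_Ico_consecutive _ (hik.trans (Nat.le_succ k)) hmj,
      Finset.sum_Ico_succ_top hik]
    simp only [map_sub, sub_apply]
    abel
  rw [hdecomp]
  have f3 := ((y (t k) - y (t i)).le_opNorm (ω (t (k + 1)) - ω (t k))).trans e3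
  have f4 := ((y (t (k + 1)) - y (t i)).le_opNorm (ω (t j) - ω (t (k + 1)))).trans e4
  refine (norm_add_le _ _).trans (le_trans (add_le_add ((norm_add_le _ _).trans (add_le_add e1 e2))
    ((norm_add_le _ _).trans (add_le_add f3 f4))) ?_)
  have g1 := mul_le_mul_of_nonneg_left e1' (mul_nonneg hK.le hD)
  have g2 := mul_le_mul_of_nonneg_left e2' (mul_nonneg hK.le hD)
  have g3 := mul_le_mul_of_nonneg_left e3' hD
  have := sewConst_eq hθ hW0
  have h5 : sewConst θ * D * w (t i) (t j) ^ θ =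
    D * (2 * (sewConst θ * (w (t i) (t j) / 2) ^ θ) + 2 * w (t i) (t j) ^ θ) := by
    rw [this]; ring
  rw [h5]
  linarith

/-- The left Riemann sums of `y` against `ω` on `[a,t]` along the uniform partition of `[a,b]`. -/
def uniformSum (y : ℝ → E →L[ℝ] F) (ω : ℝ → E) (a b : ℝ) (n : ℕ) (t : ℝ) : F :=
  ∑ k ∈ Finset.range n, y (a + k * ((b - a) / n))
    (ω (min (a + (k + 1 : ℕ) * ((b - a) / n)) t) - ω (min (a + k * ((b - a) / n)) t))

lemma norm_uniformSum_sub_le {a b B o : ℝ} {w : ℝ → ℝ → ℝ} {y : ℝ → E →L[ℝ] F} {ω : ℝ → E}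
    {n : ℕ} (hn : 0 < n) (hB : 0 ≤ B) (ho : 0 ≤ o)
    (hyB : ∀ s t, a ≤ s → s ≤ t → t ≤ b → ‖y t - y s‖ ≤ B)
    (hosc : ∀ s t, a ≤ s → s ≤ t → t ≤ b → t - s ≤ (b - a) / n → ‖ω t - ω s‖ ≤ o)
    {u v : ℝ} (hau : a ≤ u) (huv : u ≤ v) (hvb : v ≤ b) (hw : SuperAddOn u v w)
    {θ D : ℝ} (hθ : 1 < θ) (hD : 0 ≤ D)
    (hprod : ∀ s t r, u ≤ s → s ≤ t → t ≤ r → r ≤ v →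
      ‖y t - y s‖ * ‖ω r - ω t‖ ≤ D * w s r ^ θ) :
    ‖uniformSum y ω a b n v - uniformSum y ω a b n u - y u (ω v - ω u)‖ ≤
      sewConst θ * D * w u v ^ θ + B * o := by
  set τ : ℕ → ℝ := fun k => a + k * ((b - a) / n) with hτ
  have hstep : 0 ≤ (b - a) / n := div_nonneg (by linarith) (by positivity)
  have hτs : ∀ k, τ (k + 1) = τ k + (b - a) / n := fun k => by simp only [hτ]; push_cast; ring
  have hτm : Monotone τ := monotone_nat_of_le_succ fun k => by rw [hτs]; linarith
  have hτ0 : τ 0 = a := by simp [hτ]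
  have hτn : τ n = b := by
    have : (n : ℝ) ≠ 0 := by positivity
    simp only [hτ]; field_simp; ring
  set c : ℕ → ℝ := fun k => max u (min v (τ k)) with hc
  have hcm : Monotone c := fun i j hij => max_le_max_left _ (min_le_min_left _ (hτm hij))
  have hc0 : c 0 = u := by simp [hc, hτ0, hau]
  have hcn : c n = v := by simp [hc, hτn, hvb, huv]
  have hcu : ∀ k, u ≤ c k := fun k => le_max_left _ _
  have hcv : ∀ k, c k ≤ v := fun k => max_le huv (min_le_left _ _)
  have hclip : ∀ r, ω (max u (min v r)) = ω (min r v) - ω (min r u) + ω u := by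
    intro r
    rcases le_total r u with h | h
    · simp [h, h.trans huv]
    · rcases le_total r v with h' | h'
      · simp [h, h']
      · simp [h, h', huv]
  have hI : uniformSum y ω a b n v - uniformSum y ω a b n u =
      ∑ k ∈ Finset.range n, y (τ k) (ω (c (k + 1)) - ω (c k)) := by
    unfold uniformSum
    rw [← Finset.sum_sub_distrib]
    refine Finset.sum_congr rfl fun k _ => ?_
    rw [← map_sub]
    congr 1
    simp only [hc, hclip, hτ]
    abel
  have e1 := norm_sum_sub_le hθ hD hw hprod hcm 0 n (Nat.zero_le n) (hcu 0) (hcv n)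
  rw [hc0, hcn, Nat.Ico_zero_eq_range] at e1
  have e2 : ‖∑ k ∈ Finset.range n, (y (τ k) - y (c k)) (ω (c (k + 1)) - ω (c k))‖ ≤ B * o := by
    classical
    have hzero : ∀ k ∈ Finset.range n, (y (τ k) - y (c k)) (ω (c (k + 1)) - ω (c k)) ≠ 0 →
        τ k < u ∧ u < τ (k + 1) := by
      intro k _ hne
      by_contra hcon
      apply hne
      rcases le_or_gt u (τ k) with h | h
      · rcases le_total (τ k) v with h' | h'
        · have : c k = τ k := by simp [hc, h, h']
          rw [this, sub_self, zero_apply]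
        · have h1 : c k = v := by simp [hc, h', huv]
          have h2 : c (k + 1) = v := by
            simp [hc, h'.trans (hτm (Nat.le_succ k)), huv]
          rw [h1, h2, sub_self, map_zero]
      · have h2 : τ (k + 1) ≤ u := by
          by_contra h3
          exact hcon ⟨h, not_le.1 h3⟩
        have h1 : c k = u := by
          simp only [hc]; exact max_eq_left ((min_le_right _ _).trans h.le)
        have h2 : c (k + 1) = u := by
          simp only [hc]; exact max_eq_left ((min_le_right _ _).trans h2)
        rw [h1, h2, sub_self, map_zero]
    rw [← Finset.sum_filter_of_ne hzero]
    refine (norm_sum_le _ _).trans ((Finset.sum_le_card_nsmul _ _ (B * o) ?_).trans ?_)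
    · intro k hk
      obtain ⟨hk, h1, h2⟩ := Finset.mem_filter.1 hk
      have hk' : k < n := Finset.mem_range.1 hk
      have hck : c k = u := by
        simp only [hc]; exact max_eq_left ((min_le_right _ _).trans h1.le)
      refine (ContinuousLinearMap.le_opNorm _ _).trans (mul_le_mul ?_ ?_ (norm_nonneg _) hB)
      · rw [norm_sub_rev, hck]
        exact hyB _ _ (hτ0 ▸ hτm (Nat.zero_le k)) h1.le (huv.trans hvb)
      · refine hosc _ _ (hau.trans (hcu _)) (hcm (Nat.le_succ k)) ((hcv _).trans hvb) ?_
        have : c (k + 1) ≤ τ (k + 1) := max_le h2.le (min_le_right _ _)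
        rw [hck]
        rw [hτs] at this
        linarith
    · have hcard : (Finset.filter (fun k => τ k < u ∧ u < τ (k + 1)) (Finset.range n)).card ≤ 1 := by
        rw [Finset.card_le_one]
        intro i hi j hj
        obtain ⟨-, hi1, hi2⟩ := Finset.mem_filter.1 hi
        obtain ⟨-, hj1, hj2⟩ := Finset.mem_filter.1 hj
        by_contra hne
        rcases Nat.lt_or_gt_of_ne hne with h | h
        · exact absurd (hτm h) (not_le.2 (hj1.trans hi2))
        · exact absurd (hτm h) (not_le.2 (hi1.trans hj2))
      rw [nsmul_eq_mul]
      have : ((Finset.filter (fun k => τ k < u ∧ u < τ (k + 1)) (Finset.range n)).card : ℝ) ≤ 1 := by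
        exact_mod_cast hcard
      exact mul_le_of_le_one_left (mul_nonneg hB ho) this
  have hsum : uniformSum y ω a b n v - uniformSum y ω a b n u - y u (ω v - ω u) =
      (∑ k ∈ Finset.range n, y (c k) (ω (c (k + 1)) - ω (c k)) - y u (ω v - ω u)) +
      ∑ k ∈ Finset.range n, (y (τ k) - y (c k)) (ω (c (k + 1)) - ω (c k)) := by
    rw [hI]
    simp only [sub_apply, Finset.sum_sub_distrib]
    abel
  rw [hsum]
  exact (norm_add_le _ _).trans (add_le_add e1 e2)

open Filter Topology in
/-- The indefinite Young integral: an additive functional satisfying the Young–Loève estimate with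
respect to every admissible control of every subinterval. -/
lemma exists_young_functional [ProperSpace F] {a b D₁ θ₀ D₀ : ℝ} (hab : a ≤ b) {w : ℝ → ℝ → ℝ}
    {y : ℝ → E →L[ℝ] F} {ω : ℝ → E} (hω : ContinuousOn ω (Set.Icc a b)) (hD₁ : 0 ≤ D₁)
    (hy : ∀ s t, a ≤ s → s ≤ t → t ≤ b → ‖y t - y s‖ ≤ D₁)
    (hw : SuperAddOn a b w) (hθ₀ : 1 < θ₀) (hD₀ : 0 ≤ D₀)
    (hprod : ∀ s t r, a ≤ s → s ≤ t → t ≤ r → r ≤ b →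
      ‖y t - y s‖ * ‖ω r - ω t‖ ≤ D₀ * w s r ^ θ₀) :
    ∃ I : ℝ → F, ∀ u v, a ≤ u → u ≤ v → v ≤ b → ∀ (w' : ℝ → ℝ → ℝ) (θ D : ℝ),
      SuperAddOn u v w' → 1 < θ → 0 ≤ D →
      (∀ s t r, u ≤ s → s ≤ t → t ≤ r → r ≤ v → ‖y t - y s‖ * ‖ω r - ω t‖ ≤ D * w' s r ^ θ) →
      ‖I v - I u - y u (ω v - ω u)‖ ≤ sewConst θ * D * w' u v ^ θ := by
  obtain ⟨M, hM⟩ : ∃ M, ∀ s ∈ Set.Icc a b, ‖ω s‖ ≤ M :=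
    isCompact_Icc.exists_bound_of_continuousOn hω
  have hM0 : 0 ≤ M := (norm_nonneg _).trans (hM a ⟨le_rfl, hab⟩)
  have hK := sewConst_pos hθ₀
  let U : Ultrafilter ℕ := Ultrafilter.of atTop
  have hU : (U : Filter ℕ) ≤ atTop := Ultrafilter.of_le _
  have hbound : ∀ u v, a ≤ u → u ≤ v → v ≤ b → ∀ (w' : ℝ → ℝ → ℝ) (θ D : ℝ),
      SuperAddOn u v w' → 1 < θ → 0 ≤ D →
      (∀ s t r, u ≤ s → s ≤ t → t ≤ r → r ≤ v → ‖y t - y s‖ * ‖ω r - ω t‖ ≤ D * w' s r ^ θ) →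
      ∀ o > 0, ∀ᶠ n in atTop,
        ‖uniformSum y ω a b n v - uniformSum y ω a b n u - y u (ω v - ω u)‖ ≤
          sewConst θ * D * w' u v ^ θ + D₁ * o := by
    intro u v hu huv hv w' θ D hw' hθ hD hp o ho
    obtain ⟨ρ, hρ, hosc⟩ := hω.exists_osc_le ho
    have hlim : Tendsto (fun n : ℕ => (b - a) / (n : ℝ)) atTop (𝓝 0) :=
      tendsto_const_div_atTop_nhds_zero_nat _
    filter_upwards [hlim.eventually (gt_mem_nhds hρ), eventually_gt_atTop 0] with n hn hn0
    exact norm_uniformSum_sub_le hn0 hD₁ ho.le hy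
      (fun s t hs hst ht hd => hosc s t hs hst ht (hd.trans hn.le)) hu huv hv hw' hθ hD hp
  have hzero : ∀ n, uniformSum y ω a b n a = 0 := by
    intro n
    unfold uniformSum
    refine Finset.sum_eq_zero fun k _ => ?_
    have h0 : 0 ≤ (b - a) / (n : ℝ) := div_nonneg (by linarith) (by positivity)
    have h1 : ∀ k : ℕ, min (a + k * ((b - a) / n)) a = a := fun k =>
      min_eq_right (le_add_of_nonneg_right (by positivity))
    rw [h1, h1, sub_self, map_zero]
  have hex : ∀ t ∈ Set.Icc a b, ∃ l, Tendsto (fun n => uniformSum y ω a b n t) U (𝓝 l) := by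
    intro t ht
    have h1 := hbound a t le_rfl ht.1 ht.2 w θ₀ D₀ (hw.restrict le_rfl ht.2) hθ₀ hD₀
      (fun s t' r h1 h2 h3 h4 => hprod s t' r h1 h2 h3 (h4.trans ht.2)) 1 one_pos
    have h2 : ∀ᶠ n in (U : Filter ℕ), uniformSum y ω a b n t ∈
        Metric.closedBall (y a (ω t - ω a)) (sewConst θ₀ * D₀ * w a t ^ θ₀ + D₁ * 1) := by
      filter_upwards [h1.filter_mono hU] with n hn
      rw [hzero, sub_zero] at hn
      rwa [Metric.mem_closedBall, dist_eq_norm]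
    obtain ⟨l, -, hl⟩ := (isCompact_closedBall _ _).ultrafilter_le_nhds
      (U.map fun n => uniformSum y ω a b n t) (le_principal_iff.2 h2)
    exact ⟨l, hl⟩
  choose! I hI using hex
  refine ⟨I, fun u v hu huv hv w' θ D hw' hθ hD hp => ?_⟩
  have hlim : Tendsto (fun n => ‖uniformSum y ω a b n v - uniformSum y ω a b n u
      - y u (ω v - ω u)‖) U (𝓝 ‖I v - I u - y u (ω v - ω u)‖) :=
    (((hI v ⟨hu.trans huv, hv⟩).sub (hI u ⟨hu, huv.trans hv⟩)).sub_const _).norm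
  refine le_of_forall_pos_le_add fun ε hε => ?_
  have h1 := (hbound u v hu huv hv w' θ D hw' hθ hD hp (ε / (D₁ + 1))
    (by positivity)).filter_mono hU
  refine (le_of_tendsto hlim h1).trans ?_
  gcongr
  rw [mul_div_assoc']
  rw [div_le_iff₀ (by positivity)]
  nlinarith

end Sewing

lemma le_interpolate {r o D z ν κ : ℝ} (hr : 0 ≤ r) (hD : 0 ≤ D) (hz : 0 ≤ z)
    (hκ0 : 0 ≤ κ) (hκ1 : κ ≤ 1) (h1 : r ≤ o) (h2 : r ≤ D * z ^ ν) :
    r ≤ o ^ (1 - κ) * D ^ κ * z ^ (ν * κ) := by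
  calc r = r ^ (1 - κ) * r ^ κ := by
        rw [← Real.rpow_add_of_nonneg hr (by linarith) hκ0, sub_add_cancel, Real.rpow_one]
    _ ≤ o ^ (1 - κ) * (D * z ^ ν) ^ κ := by
        have := hr.trans h1
        gcongr
    _ = _ := by
        rw [Real.mul_rpow hD (by positivity), ← Real.rpow_mul hz, mul_assoc]

section Integral

variable {E F : Type*} [NormedAddCommGroup E] [NormedSpace ℝ E]
  [NormedAddCommGroup F] [NormedSpace ℝ F]

lemma exists_taggedPartition {a b δ : ℝ} (hab : a ≤ b) (hδ : 0 < δ) :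
    ∃ P : TaggedPartition a b, P.mesh < δ := by
  rcases hab.eq_or_lt with rfl | hlt
  · refine ⟨⟨0, fun _ => a, fun _ => a, fun i j hij => absurd hij (by omega), rfl, rfl,
      fun i => i.elim0⟩, ?_⟩
    unfold TaggedPartition.mesh
    rw [Real.iSup_of_isEmpty]
    exact hδ
  · obtain ⟨n, hn⟩ := exists_nat_gt ((b - a) / δ)
    have hn0 : (0 : ℝ) < n := lt_of_le_of_lt (div_nonneg (by linarith) hδ.le) hn
    have hs : 0 < (b - a) / n := div_pos (by linarith) hn0
    have hsδ : (b - a) / n < δ := by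
      rw [div_lt_iff₀ hn0]
      rw [div_lt_iff₀ hδ] at hn
      linarith
    have hstep : ∀ i : Fin n, a + (i.succ : ℕ) * ((b - a) / n)
        - (a + (i.castSucc : ℕ) * ((b - a) / n)) = (b - a) / n := by
      intro i
      simp only [Fin.val_succ, Fin.val_castSucc]
      push_cast
      ring
    refine ⟨⟨n, fun i => a + (i : ℕ) * ((b - a) / n),
      fun i => a + (i.castSucc : ℕ) * ((b - a) / n), ?_, by simp, ?_, ?_⟩, ?_⟩
    · rw [Fin.strictMono_iff_lt_succ]
      intro i
      linarith [hstep i]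
    · simp only [Fin.val_last]
      field_simp
      ring
    · intro i
      exact ⟨le_rfl, by linarith [hstep i]⟩
    · unfold TaggedPartition.mesh
      simp only [hstep]
      have : Nonempty (Fin n) := ⟨⟨0, by exact_mod_cast hn0⟩⟩
      rwa [ciSup_const]

lemma TaggedPartition.sub_le_mesh {a b : ℝ} (P : TaggedPartition a b) (i : Fin P.n) :
    P.t i.succ - P.t i.castSucc ≤ P.mesh :=
  le_ciSup (f := fun i : Fin P.n => P.t i.succ - P.t i.castSucc) (Set.finite_range _).bddAbove i

lemma IsYoungIntegral.unique {x : ℝ → E →L[ℝ] F} {ω : ℝ → E} {a b : ℝ} (hab : a ≤ b) {v v' : F}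
    (hv : IsYoungIntegral x ω a b v) (hv' : IsYoungIntegral x ω a b v') : v = v' := by
  by_contra hne
  have hε : 0 < ‖v - v'‖ / 2 := half_pos (norm_pos_iff.2 (sub_ne_zero.2 hne))
  obtain ⟨δ, hδ, h1⟩ := hv _ hε
  obtain ⟨δ', hδ', h2⟩ := hv' _ hε
  obtain ⟨P, hP⟩ := exists_taggedPartition hab (lt_min hδ hδ')
  have e1 := h1 P (hP.trans_le (min_le_left _ _))
  have e2 := h2 P (hP.trans_le (min_le_right _ _))
  have e3 : ‖v - v'‖ ≤ ‖RSSum x ω P - v'‖ + ‖RSSum x ω P - v‖ := by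
    have : v - v' = (RSSum x ω P - v') - (RSSum x ω P - v) := by abel
    rw [this]
    exact norm_sub_le _ _
  linarith

lemma IsYoungIntegral.youngIntegral_eq {x : ℝ → E →L[ℝ] F} {ω : ℝ → E} {a b : ℝ} (hab : a ≤ b)
    {v : F} (hv : IsYoungIntegral x ω a b v) : youngIntegral x ω a b = v := by
  have hex : ∃ v, IsYoungIntegral x ω a b v := ⟨v, hv⟩
  unfold youngIntegral
  rw [dif_pos hex]
  exact hex.choose_spec.unique hab hv

lemma isYoungIntegral_of_functional {a b D₁ D₂ μ ν : ℝ} (hab : a ≤ b) {w : ℝ → ℝ → ℝ}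
    {y : ℝ → E →L[ℝ] F} {ω : ℝ → E} (hω : ContinuousOn ω (Set.Icc a b)) (hw : SuperAddOn a b w)
    (hμ : 0 < μ) (hν : 0 < ν) (hμν : 1 < μ + ν) (hD₁ : 0 ≤ D₁) (hD₂ : 0 ≤ D₂)
    (hy : ∀ s t, a ≤ s → s ≤ t → t ≤ b → ‖y t - y s‖ ≤ D₁ * w s t ^ μ)
    (hδω : ∀ s t, a ≤ s → s ≤ t → t ≤ b → ‖ω t - ω s‖ ≤ D₂ * w s t ^ ν) {I : ℝ → F}
    (hI : ∀ u v, a ≤ u → u ≤ v → v ≤ b → ∀ (w' : ℝ → ℝ → ℝ) (θ D : ℝ),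
      SuperAddOn u v w' → 1 < θ → 0 ≤ D →
      (∀ s t r, u ≤ s → s ≤ t → t ≤ r → r ≤ v → ‖y t - y s‖ * ‖ω r - ω t‖ ≤ D * w' s r ^ θ) →
      ‖I v - I u - y u (ω v - ω u)‖ ≤ sewConst θ * D * w' u v ^ θ) :
    IsYoungIntegral y ω a b (I b - I a) := by
  intro ε hε
  obtain ⟨ν', h1, h2⟩ := exists_between (max_lt (by linarith : 1 - μ < ν) hν)
  have h1a : 1 < μ + ν' := by linarith [le_max_left (1 - μ) 0]
  have h1b : 0 < ν' := (le_max_right _ _).trans_lt h1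
  set κ := ν' / ν with hκ
  have hκ0 : 0 < κ := by positivity
  have hκ1 : κ < 1 := (div_lt_one hν).2 h2
  have hνκ : ν * κ = ν' := by rw [hκ]; field_simp
  set θ := μ + ν' with hθ
  have hK := sewConst_pos h1a
  have hw0 : 0 ≤ w a b := hw.1 a b le_rfl hab le_rfl
  set Q := (1 + sewConst θ) * (D₁ * D₂ ^ κ) * w a b ^ θ with hQ
  have hQ0 : 0 ≤ Q := by positivity
  set η := ε / (Q + 1) with hη
  have hη0 : 0 < η := by positivity
  have hκ' : 1 - κ ≠ 0 := by linarith
  obtain ⟨ρ, hρ, hosc⟩ := hω.exists_osc_le (o := η ^ (1 / (1 - κ))) (by positivity)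
  have hη' : (η ^ (1 / (1 - κ))) ^ (1 - κ) = η := by
    rw [← Real.rpow_mul hη0.le, one_div_mul_cancel hκ', Real.rpow_one]
  refine ⟨ρ, hρ, fun P hP => ?_⟩
  have hprod : ∀ s t r, a ≤ s → s ≤ t → t ≤ r → r ≤ b → r - s ≤ ρ → ∀ u, s ≤ u → u ≤ t →
      ‖y t - y s‖ * ‖ω r - ω u‖ ≤ D₁ * D₂ ^ κ * η * w s r ^ θ := by
    intro s t r hs hst htr hr hd u hsu hut
    have e1 := hy s t hs hst (htr.trans hr)
    have e2 := le_interpolate (norm_nonneg _) hD₂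
      (hw.1 u r (hs.trans hsu) (hut.trans htr) hr) hκ0.le hκ1.le
      (hosc u r (hs.trans hsu) (hut.trans htr) hr (by linarith))
      (hδω u r (hs.trans hsu) (hut.trans htr) hr)
    rw [hη', hνκ] at e2
    have m1 := hw.mono hs le_rfl hst htr hr
    have m2 := hw.mono hs hsu (hut.trans htr) le_rfl hr
    have n1 := hw.1 s t hs hst (htr.trans hr)
    have n2 := hw.1 u r (hs.trans hsu) (hut.trans htr) hr
    calc _ ≤ (D₁ * w s r ^ μ) * (η * D₂ ^ κ * w s r ^ ν') := by
          refine mul_le_mul (e1.trans (by gcongr)) (e2.trans (by gcongr)) (norm_nonneg _) ?_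
          have := n1.trans m1
          positivity
      _ = _ := by
          rw [hθ, Real.rpow_add_of_nonneg (n1.trans m1) hμ.le h1b.le]
          ring
  have hterm : ∀ s r ξ, a ≤ s → s ≤ r → r ≤ b → r - s ≤ ρ → s ≤ ξ → ξ ≤ r →
      ‖y ξ (ω r - ω s) - (I r - I s)‖ ≤
        (1 + sewConst θ) * (D₁ * D₂ ^ κ) * η * w s r ^ θ := by
    intro s r ξ hs hsr hr hd h3 h4
    have e1 := hI s r hs hsr hr w θ (D₁ * D₂ ^ κ * η) (hw.restrict hs hr) h1a (by positivity)
      (fun s' t' r' i1 i2 i3 i4 => hprod s' t' r' (hs.trans i1) i2 i3 (i4.trans hr)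
        (by linarith) t' i2 le_rfl)
    have e2 : ‖(y ξ - y s) (ω r - ω s)‖ ≤ D₁ * D₂ ^ κ * η * w s r ^ θ :=
      (ContinuousLinearMap.le_opNorm _ _).trans (hprod s ξ r hs h3 h4 hr hd s le_rfl h3)
    have e3 : y ξ (ω r - ω s) - (I r - I s) =
        (y ξ - y s) (ω r - ω s) - (I r - I s - y s (ω r - ω s)) := by
      rw [sub_apply]; abel
    rw [e3]
    refine (norm_sub_le _ _).trans ((add_le_add e2 e1).trans (le_of_eq ?_))
    ring
  have hm := extendFin_monotone P.mono
  have h0' : extendFin P.t 0 = a := by rw [extendFin_zero, P.first]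
  have h1' : extendFin P.t P.n = b := by rw [extendFin_last, P.last]
  have hmem : ∀ i, a ≤ P.t i ∧ P.t i ≤ b := fun i =>
    ⟨P.first.ge.trans (P.mono.monotone (Fin.zero_le i)),
      (P.mono.monotone (Fin.le_last i)).trans P.last.le⟩
  have htel : I b - I a = ∑ i : Fin P.n, (I (P.t i.succ) - I (P.t i.castSucc)) := by
    rw [sum_extendFin P.t fun r s => I s - I r, Finset.sum_range_sub (fun k => I (extendFin P.t k)),
      h0', h1']
  have hsum : ∑ i : Fin P.n, w (P.t i.castSucc) (P.t i.succ) ^ θ ≤ w a b ^ θ := by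
    rw [sum_extendFin P.t fun r s => w r s ^ θ]
    have := hw.sum_rpow_le hm P.n h0'.ge h1'.le h1a.le
    rwa [h0', h1'] at this
  rw [htel, RSSum, ← Finset.sum_sub_distrib]
  refine (norm_sum_le _ _).trans_lt ?_
  calc _ ≤ ∑ i : Fin P.n, (1 + sewConst θ) * (D₁ * D₂ ^ κ) * η *
          w (P.t i.castSucc) (P.t i.succ) ^ θ := by
        refine Finset.sum_le_sum fun i _ => ?_
        exact hterm _ _ _ (hmem _).1 (P.mono.monotone (Fin.castSucc_le_succ i)) (hmem _).2
          ((P.sub_le_mesh i).trans hP.le) (P.tag_mem i).1 (P.tag_mem i).2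
    _ ≤ (1 + sewConst θ) * (D₁ * D₂ ^ κ) * η * w a b ^ θ := by
        rw [← Finset.mul_sum]
        gcongr
    _ = Q * (ε / (Q + 1)) := by rw [hQ, hη]; ring
    _ < ε := by
        rw [mul_div_assoc', div_lt_iff₀ (by positivity)]
        nlinarith

/-- Existence of the Young integral, together with the Young–Loève estimate for its increments. -/
lemma exists_youngIntegral_eq [ProperSpace F] {a b D₁ D₂ μ ν : ℝ} (hab : a ≤ b)
    {w : ℝ → ℝ → ℝ} {y : ℝ → E →L[ℝ] F} {ω : ℝ → E} (hω : ContinuousOn ω (Set.Icc a b))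
    (hw : SuperAddOn a b w) (hμ : 0 < μ) (hν : 0 < ν) (hμν : 1 < μ + ν) (hD₁ : 0 ≤ D₁)
    (hD₂ : 0 ≤ D₂) (hy : ∀ s t, a ≤ s → s ≤ t → t ≤ b → ‖y t - y s‖ ≤ D₁ * w s t ^ μ)
    (hδω : ∀ s t, a ≤ s → s ≤ t → t ≤ b → ‖ω t - ω s‖ ≤ D₂ * w s t ^ ν) :
    ∃ I : ℝ → F, (∀ t ∈ Set.Icc a b, youngIntegral y ω a t = I t - I a) ∧
      ∀ u v, a ≤ u → u ≤ v → v ≤ b → ∀ (w' : ℝ → ℝ → ℝ) (μ' ν' D₁' D₂' : ℝ),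
      SuperAddOn u v w' → 0 < μ' → 0 < ν' → 1 < μ' + ν' → 0 ≤ D₁' → 0 ≤ D₂' →
      (∀ s t, u ≤ s → s ≤ t → t ≤ v → ‖y t - y s‖ ≤ D₁' * w' s t ^ μ') →
      (∀ s t, u ≤ s → s ≤ t → t ≤ v → ‖ω t - ω s‖ ≤ D₂' * w' s t ^ ν') →
      ‖I v - I u - y u (ω v - ω u)‖ ≤
        sewConst (μ' + ν') * (D₁' * D₂') * w' u v ^ (μ' + ν') := by
  have hprod : ∀ u v (w' : ℝ → ℝ → ℝ) (μ' ν' D₁' D₂' : ℝ),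
      SuperAddOn u v w' → 0 < μ' → 0 < ν' → 0 ≤ D₁' → 0 ≤ D₂' →
      (∀ s t, u ≤ s → s ≤ t → t ≤ v → ‖y t - y s‖ ≤ D₁' * w' s t ^ μ') →
      (∀ s t, u ≤ s → s ≤ t → t ≤ v → ‖ω t - ω s‖ ≤ D₂' * w' s t ^ ν') →
      ∀ s t r, u ≤ s → s ≤ t → t ≤ r → r ≤ v →
        ‖y t - y s‖ * ‖ω r - ω t‖ ≤ D₁' * D₂' * w' s r ^ (μ' + ν') := by
    intro u v w' μ' ν' D₁' D₂' hw' hμ' hν' h1 h2 hy' hω' s t r hs hst htr hr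
    have n1 := hw'.1 s t hs hst (htr.trans hr)
    have n2 := hw'.1 t r (hs.trans hst) htr hr
    have m1 := hw'.mono hs le_rfl hst htr hr
    have m2 := hw'.mono hs hst htr le_rfl hr
    have n3 := n1.trans m1
    rw [Real.rpow_add_of_nonneg n3 hμ'.le hν'.le]
    calc _ ≤ (D₁' * w' s r ^ μ') * (D₂' * w' s r ^ ν') :=
          mul_le_mul ((hy' s t hs hst (htr.trans hr)).trans (by gcongr))
            ((hω' t r (hs.trans hst) htr hr).trans (by gcongr)) (norm_nonneg _) (by positivity)
      _ = _ := by ring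
  have hwab := hw.1 a b le_rfl hab le_rfl
  obtain ⟨I, hI⟩ := exists_young_functional hab hω (D₁ := D₁ * w a b ^ μ) (by positivity)
    (fun s t hs hst ht => (hy s t hs hst ht).trans (by
      have := hw.1 s t hs hst ht
      have := hw.mono le_rfl hs hst ht le_rfl
      gcongr)) hw hμν (mul_nonneg hD₁ hD₂) (hprod a b w μ ν D₁ D₂ hw hμ hν hD₁ hD₂ hy hδω)
  refine ⟨I, fun t ht => ?_, ?_⟩
  · refine IsYoungIntegral.youngIntegral_eq ht.1 ?_
    exact isYoungIntegral_of_functional ht.1 (hω.mono (Set.Icc_subset_Icc le_rfl ht.2))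
      (hw.restrict le_rfl ht.2) hμ hν hμν hD₁ hD₂
      (fun s r h1 h2 h3 => hy s r h1 h2 (h3.trans ht.2))
      (fun s r h1 h2 h3 => hδω s r h1 h2 (h3.trans ht.2))
      (fun u v h1 h2 h3 => hI u v h1 h2 (h3.trans ht.2))
  · intro u v hu huv hv w' μ' ν' D₁' D₂' hw' hμ' hν' hμν' h1 h2 hy' hω'
    exact hI u v hu huv hv w' (μ' + ν') (D₁' * D₂') hw' hμν' (mul_nonneg h1 h2)
      (hprod u v w' μ' ν' D₁' D₂' hw' hμ' hν' h1 h2 hy' hω')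

end Integral

section Growth

lemma mul_rpow_le_mul_rpow {c r e e' : ℝ} (hc : 1 ≤ c) (hr0 : 0 ≤ r) (hr1 : r ≤ 1) (he' : 0 ≤ e')
    (hee : e' ≤ e) (he : e ≤ 1) : (c * r) ^ e ≤ c * r ^ e' := by
  rw [Real.mul_rpow (by linarith) hr0]
  have h1 : c ^ e ≤ c := by
    simpa using Real.rpow_le_rpow_of_exponent_le hc he
  have h2 : r ^ e ≤ r ^ e' := Real.rpow_le_rpow_of_exponent_ge_of_imp hr0 hr1 hee
    (fun h h' => by linarith)
  gcongr

/-- Concatenation of local growth bounds along a superadditive function. -/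
lemma pVar_growth_of_local {F : Type*} [NormedAddCommGroup F] {t₀ T q η ρ A : ℝ} {x : ℝ → F} {V : ℝ → ℝ → ℝ}
    (hq : 1 ≤ q) (hx : FinitePVar q x t₀ T) (hV : SuperAddOn t₀ T V) (hη : 0 < η) (hρ : 0 < ρ) (hA : 2 ≤ A)
    (h1 : ∀ s t, t₀ ≤ s → s ≤ t → t ≤ T → V s t ≤ η →
      1 + ‖x s‖ + pVar q x s t ≤ A * (1 + ‖x s‖))
    (h2 : ∀ s t, t₀ ≤ s → s ≤ t → t ≤ T → t - s ≤ ρ →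
      1 + ‖x s‖ + pVar q x s t ≤ A * (1 + ‖x s‖)) (n : ℕ) :
    ∀ s, t₀ ≤ s → s ≤ T → V s T ≤ (n + 1) * η →
      1 + ‖x s‖ + pVar q x s T ≤ A ^ (4 * n + 1) * (1 + ‖x s‖) := by
  have hq0 : 0 < q := by linarith
  have hglue : ∀ (s t : ℝ) (k : ℕ), t₀ ≤ s → s ≤ t → t ≤ T → 1 ≤ k →
      1 + ‖x s‖ + pVar q x s t ≤ A * (1 + ‖x s‖) →
      1 + ‖x t‖ + pVar q x t T ≤ A ^ k * (1 + ‖x t‖) →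
      1 + ‖x s‖ + pVar q x s T ≤ A ^ (k + 2) * (1 + ‖x s‖) := by
    intro s t k hs hst ht hk e1 e2
    have e3 := pVar_le_add hq (hx.restrict hs le_rfl) hst ht
    have e4 : ‖x t - x s‖ ≤ pVar q x s t := hx.norm_le hq0 hs hst ht
    have e5 := norm_add_le (x s) (x t - x s)
    rw [add_sub_cancel] at e5
    have e6 : A ^ k * (1 + ‖x t‖) ≤ A ^ k * (A * (1 + ‖x s‖)) := by
      gcongr
      linarith
    have e7 : A * (1 + ‖x s‖) ≤ A ^ (k + 1) * (1 + ‖x s‖) := by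
      gcongr
      exact le_self_pow₀ (by linarith) (by omega)
    have e8 : 2 * (A ^ (k + 1) * (1 + ‖x s‖)) ≤ A * (A ^ (k + 1) * (1 + ‖x s‖)) := by
      gcongr
    have e9 : A * (A ^ (k + 1) * (1 + ‖x s‖)) = A ^ (k + 2) * (1 + ‖x s‖) := by ring
    have e10 : A ^ k * (A * (1 + ‖x s‖)) = A ^ (k + 1) * (1 + ‖x s‖) := by ring
    linarith [norm_nonneg (x t)]
  induction n with
  | zero =>
    intro s hs hsT hVs
    have := h1 s T hs hsT le_rfl (by simpa using hVs)
    simpa using this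
  | succ n ih =>
    intro s hs hsT hVs
    set S : Set ℝ := {t | s ≤ t ∧ t ≤ T ∧ V s t ≤ η} with hS
    have hsS : s ∈ S := by
      refine ⟨le_rfl, hsT, ?_⟩
      have := hV.2 s s s hs le_rfl le_rfl hsT
      linarith
    have hSb : BddAbove S := ⟨T, fun t ht => ht.2.1⟩
    obtain ⟨σ, hσS, hσ⟩ := exists_lt_of_lt_csSup ⟨s, hsS⟩ (sub_lt_self (sSup S) (half_pos hρ))
    obtain ⟨hsσ, hσT, hVσ⟩ := hσS
    set τ := min (σ + ρ) T with hτ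
    have hστ : σ ≤ τ := le_min (by linarith) hσT
    have hτT : τ ≤ T := min_le_right _ _
    have htail : 1 + ‖x τ‖ + pVar q x τ T ≤ A ^ (4 * n + 1) * (1 + ‖x τ‖) := by
      refine ih τ (hs.trans (hsσ.trans hστ)) hτT ?_
      rcases hτT.eq_or_lt with h | h
      · rw [h]
        have := hV.2 T T T (hs.trans hsT) le_rfl le_rfl le_rfl
        have : 0 ≤ ((n : ℝ) + 1) * η := by positivity
        linarith
      · have hτσ : τ = σ + ρ := by
          rcases min_choice (σ + ρ) T with h' | h'
          · exact h'
          · exact absurd (hτ.trans h') h.ne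
        have hnot : η < V s τ := by
          by_contra hcon
          have := le_csSup hSb (show τ ∈ S from ⟨hsσ.trans hστ, hτT, not_lt.1 hcon⟩)
          linarith
        have := hV.2 s τ T hs (hsσ.trans hστ) hτT le_rfl
        push_cast at hVs
        linarith
    have hmid := hglue σ τ _ (hs.trans hsσ) hστ hτT (by omega)
      (h2 σ τ (hs.trans hsσ) hστ hτT (by linarith [min_le_left (σ + ρ) T])) htail
    exact hglue s σ _ hs hsσ hσT (by omega) (h1 s σ hs hsσ hσT hVσ) hmid

variable {E F : Type*} [NormedAddCommGroup E] [NormedSpace ℝ E]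
  [NormedAddCommGroup F] [NormedSpace ℝ F]

/-- A single normalised control for the integrand, the driver, the drift and time. -/
lemma exists_control {s t q β μ ν Lg H B ε : ℝ} {h bb w₀ : ℝ → ℝ → ℝ} {x : ℝ → F}
    {y : ℝ → E →L[ℝ] F} {ω : ℝ → E} (hst : s ≤ t) (hq : 1 ≤ q) (hμ : 0 < μ) (hμβ : μ ≤ β)
    (hβ : β ≤ 1) (hμq : μ ≤ 1 / q) (hν : 0 < ν) (hν1 : ν ≤ 1) (hLg : 0 ≤ Lg) (hε : 0 < ε)
    (hx : FinitePVar q x s t) (hh : SuperAddOn s t h) (hbb : SuperAddOn s t bb)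
    (hw₀ : SuperAddOn s t w₀) (hH : h s t ≤ H) (hB : bb s t ≤ B) (hw₀1 : w₀ s t ≤ 1)
    (hts : t - s ≤ ε)
    (hω : ∀ u v, s ≤ u → u ≤ v → v ≤ t → ‖ω v - ω u‖ ≤ ε * w₀ u v ^ ν)
    (hy : ∀ u v, s ≤ u → u ≤ v → v ≤ t → ‖y v - y u‖ ≤ h u v ^ β + Lg * ‖x v - x u‖) :
    ∃ w, SuperAddOn s t w ∧ w s t ≤ 1 ∧ ∀ u v, s ≤ u → u ≤ v → v ≤ t →
      v - u ≤ (H + B + 3) * ε * w u v ∧ bb u v ≤ (H + B + 3) * w u v ∧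
      ‖ω v - ω u‖ ≤ (H + B + 3) * ε * w u v ^ ν ∧
      ‖y v - y u‖ ≤ (H + B + 3) * (1 + Lg) * (1 + pVar q x s t) * w u v ^ μ := by
  have hq0 : 0 < q := by linarith
  have hH0 : 0 ≤ H := (hh.1 s t le_rfl hst le_rfl).trans hH
  have hB0 : 0 ≤ B := (hbb.1 s t le_rfl hst le_rfl).trans hB
  set c := H + B + 3 with hc
  have hc1 : 1 ≤ c := by linarith
  have hc0 : 0 < c := by linarith
  set R := pVar q x s t with hR
  have hR0 : 0 ≤ R := pVar_nonneg _ _ _ _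
  have hRq : 0 < (1 + R) ^ q := by positivity
  have hX := hx.superAddOn
  have hX' := hX.div_const hRq.le
  have ht' := (superAddOn_sub s t).div_const hε.le
  have hX1 : sSup (pVarSums q x s t) / (1 + R) ^ q ≤ 1 := by
    rw [div_le_one hRq, ← pVar_rpow hq0]
    exact Real.rpow_le_rpow hR0 (by linarith) hq0.le
  have ht1 : (t - s) / ε ≤ 1 := (div_le_one hε).2 hts
  have hall := (((hh.add hX').add hw₀).add hbb).add ht'
  have hw := hall.div_const hc0.le
  refine ⟨_, hw, ?_, ?_⟩
  · rw [div_le_one hc0]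
    linarith
  intro u v hu huv hv
  have hwnn := hw.1 u v hu huv hv
  have hw1 : _ ≤ (1 : ℝ) := (hw.mono le_rfl hu huv hv le_rfl).trans (by
    rw [div_le_one hc0]
    linarith)
  dsimp only at hwnn hw1 ⊢
  have hz : c * ((h u v + sSup (pVarSums q x u v) / (1 + R) ^ q + w₀ u v + bb u v
      + (v - u) / ε) / c) = h u v + sSup (pVarSums q x u v) / (1 + R) ^ q + w₀ u v + bb u v
      + (v - u) / ε := mul_div_cancel₀ _ hc0.ne'
  have i1 := hh.1 u v hu huv hv
  have i2 := hX'.1 u v hu huv hv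
  have i3 := hw₀.1 u v hu huv hv
  have i4 := hbb.1 u v hu huv hv
  have i5 := ht'.1 u v hu huv hv
  dsimp only at i2 i5
  generalize (h u v + sSup (pVarSums q x u v) / (1 + R) ^ q + w₀ u v + bb u v
      + (v - u) / ε) / c = z at *
  have hpow : ∀ r e e' : ℝ, 0 ≤ r → r ≤ c * z → 0 ≤ e' → e' ≤ e → e ≤ 1 → r ^ e ≤ c * z ^ e' :=
    fun r e e' h0 h1 h2 h3 h4 => (Real.rpow_le_rpow h0 h1 (h2.trans h3)).trans <|
      mul_rpow_le_mul_rpow hc1 hwnn hw1 h2 h3 h4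
  refine ⟨?_, by linarith, ?_, ?_⟩
  · have : (v - u) / ε ≤ c * z := by linarith
    rw [div_le_iff₀ hε] at this
    linarith
  · refine (hω u v hu huv hv).trans ?_
    have := hpow (w₀ u v) ν ν i3 (by linarith) hν.le le_rfl hν1
    calc _ ≤ ε * (c * z ^ ν) := by gcongr
      _ = _ := by ring
  · have e1 := hpow (h u v) β μ i1 (by linarith) hμ.le hμβ hβ
    have e2 : ‖x v - x u‖ ≤ (1 + R) * (c * z ^ μ) := by
      have hXnn := sSup_pVarSums_nonneg q x u v
      have e3 := hpow _ (1 / q) μ i2 (by linarith) hμ.le hμq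
        ((div_le_one hq0).2 hq)
      rw [Real.div_rpow hXnn hRq.le, ← Real.rpow_mul (by linarith), mul_one_div_cancel hq0.ne',
        Real.rpow_one, div_le_iff₀ (by linarith)] at e3
      refine (hx.norm_le hq0 hu huv hv).trans (e3.trans (le_of_eq (by ring)))
    have hzz : 0 ≤ c * z ^ μ := by positivity
    calc _ ≤ c * z ^ μ + Lg * ((1 + R) * (c * z ^ μ)) :=
          (hy u v hu huv hv).trans (by gcongr)
      _ ≤ (1 + R) * (c * z ^ μ) + Lg * ((1 + R) * (c * z ^ μ)) := 
          add_le_add (le_mul_of_one_le_left hzz (by linarith)) le_rfl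
      _ = _ := by ring

/-- Growth over an interval on which the driver and time are small. -/
lemma local_growth {s t q β μ ν Lg H B ε G a : ℝ} {h bb w₀ : ℝ → ℝ → ℝ} {x Φ I : ℝ → F}
    {y : ℝ → E →L[ℝ] F} {ω : ℝ → E} (hst : s ≤ t) (hq : 1 ≤ q) (hμ : 0 < μ) (hμβ : μ ≤ β)
    (hβ : β ≤ 1) (hμq : μ ≤ 1 / q) (hν : 0 < ν) (hν1 : ν ≤ 1) (hμν : 1 < μ + ν)
    (hνq : 1 ≤ ν * q) (hLg : 0 ≤ Lg) (hε : 0 < ε) (hG : 0 ≤ G) (ha : 0 ≤ a)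
    (hx : FinitePVar q x s t) (hh : SuperAddOn s t h) (hbb : SuperAddOn s t bb)
    (hw₀ : SuperAddOn s t w₀) (hH : h s t ≤ H) (hB : bb s t ≤ B) (hw₀1 : w₀ s t ≤ 1)
    (hts : t - s ≤ ε)
    (hω : ∀ u v, s ≤ u → u ≤ v → v ≤ t → ‖ω v - ω u‖ ≤ ε * w₀ u v ^ ν)
    (hy : ∀ u v, s ≤ u → u ≤ v → v ≤ t → ‖y v - y u‖ ≤ h u v ^ β + Lg * ‖x v - x u‖)
    (hyG : ∀ u, s ≤ u → u ≤ t → ‖y u‖ ≤ G * (1 + ‖x u‖))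
    (hxeq : ∀ u v, s ≤ u → u ≤ v → v ≤ t → x v - x u = (Φ v - Φ u) + (I v - I u))
    (hΦ : ∀ M, (∀ r, s ≤ r → r ≤ t → ‖x r‖ ≤ M) → ∀ u v, s ≤ u → u ≤ v → v ≤ t →
      ‖Φ v - Φ u‖ ≤ a * M * (v - u) + bb u v)
    (hI : ∀ u v, s ≤ u → u ≤ v → v ≤ t → ∀ (w' : ℝ → ℝ → ℝ) (μ' ν' D₁' D₂' : ℝ),
      SuperAddOn u v w' → 0 < μ' → 0 < ν' → 1 < μ' + ν' → 0 ≤ D₁' → 0 ≤ D₂' →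
      (∀ s t, u ≤ s → s ≤ t → t ≤ v → ‖y t - y s‖ ≤ D₁' * w' s t ^ μ') →
      (∀ s t, u ≤ s → s ≤ t → t ≤ v → ‖ω t - ω s‖ ≤ D₂' * w' s t ^ ν') →
      ‖I v - I u - y u (ω v - ω u)‖ ≤
        sewConst (μ' + ν') * (D₁' * D₂') * w' u v ^ (μ' + ν'))
    (hsmall : ((H + B + 3) * (a + G) + sewConst (μ + ν) * (H + B + 3) ^ 2 * (1 + Lg)) * ε ≤ 1 / 2) :
    1 + ‖x s‖ + pVar q x s t ≤ (2 + 2 * (H + B + 3)) * (1 + ‖x s‖) := by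
  have hq0 : 0 < q := by linarith
  obtain ⟨w, hw, hw1, hwp⟩ := exists_control hst hq hμ hμβ hβ hμq hν hν1 hLg hε hx hh hbb hw₀ hH hB
    hw₀1 hts hω hy
  have hH0 : 0 ≤ H := (hh.1 s t le_rfl hst le_rfl).trans hH
  have hB0 : 0 ≤ B := (hbb.1 s t le_rfl hst le_rfl).trans hB
  set c := H + B + 3 with hc
  have hc0 : 0 < c := by linarith
  set R := pVar q x s t with hR
  have hR0 : 0 ≤ R := pVar_nonneg _ _ _ _
  have hK := sewConst_pos hμν
  set K := sewConst (μ + ν) with hKdef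
  set M := 1 + ‖x s‖ + R with hM
  have hM0 : 0 ≤ M := by positivity
  have hxM : ∀ r, s ≤ r → r ≤ t → 1 + ‖x r‖ ≤ M := by
    intro r h1 h2
    have e1 := hx.norm_le hq0 le_rfl h1 h2
    have e2 : sSup (pVarSums q x s r) ^ (1 / q) ≤ R :=
      Real.rpow_le_rpow (sSup_pVarSums_nonneg _ _ _ _)
        (hx.superAddOn.mono le_rfl le_rfl h1 h2 le_rfl) (by positivity)
    have e3 := norm_add_le (x s) (x r - x s)
    rw [add_sub_cancel] at e3
    linarith
  set C := c * (a + G) + K * c ^ 2 * (1 + Lg) with hC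
  have hC0 : 0 ≤ C := by positivity
  have hmain : R ≤ C * M * ε + c := by
    refine pVar_le_of_norm_le hq0 hνq (by positivity) hst hw hw1 fun u v hu huv hv => ?_
    obtain ⟨j1, j2, j3, -⟩ := hwp u v hu huv hv
    have hz0 := hw.1 u v hu huv hv
    have hz1 := (hw.mono le_rfl hu huv hv le_rfl).trans hw1
    have hz2 : w u v ≤ w u v ^ ν := by
      simpa using Real.rpow_le_rpow_of_exponent_ge_of_imp hz0 hz1 hν1
        (fun h h' => absurd h' one_ne_zero)
    have hz3 : w u v ^ (μ + ν) ≤ w u v ^ ν :=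
      Real.rpow_le_rpow_of_exponent_ge_of_imp hz0 hz1 (by linarith) (fun h h' => by linarith)
    have k1 := hΦ M (fun r h1 h2 => by linarith [hxM r h1 h2]) u v hu huv hv
    have k2 := hI u v hu huv hv w μ ν (c * (1 + Lg) * (1 + R)) (c * ε) (hw.restrict hu hv) hμ hν hμν
      (by positivity) (by positivity)
      (fun s' t' h1 h2 h3 => (hwp s' t' (hu.trans h1) h2 (h3.trans hv)).2.2.2)
      (fun s' t' h1 h2 h3 => (hwp s' t' (hu.trans h1) h2 (h3.trans hv)).2.2.1)
    have k3 : ‖y u (ω v - ω u)‖ ≤ G * M * (c * ε * w u v ^ ν) := by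
      refine (ContinuousLinearMap.le_opNorm _ _).trans (mul_le_mul ?_ j3 (norm_nonneg _)
        (by positivity))
      refine (hyG u hu (huv.trans hv)).trans ?_
      gcongr
      exact hxM u hu (huv.trans hv)
    have hζ : 0 ≤ w u v ^ ν := by positivity
    have l1 : ‖Φ v - Φ u‖ ≤ a * M * (c * ε * w u v ^ ν) + c * w u v ^ ν := by
      refine k1.trans (add_le_add ?_ (j2.trans ?_))
      · have : v - u ≤ c * ε * w u v ^ ν := j1.trans (by gcongr)
        gcongr
      · gcongr
    have l2 : ‖I v - I u - y u (ω v - ω u)‖ ≤ K * (c * (1 + Lg) * M * (c * ε)) * w u v ^ ν := by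
      refine k2.trans ?_
      have : 1 + R ≤ M := by linarith [norm_nonneg (x s)]
      gcongr
    have hdec : x v - x u = (Φ v - Φ u) + ((I v - I u - y u (ω v - ω u)) + y u (ω v - ω u)) := by
      rw [hxeq u v hu huv hv]; abel
    rw [hdec]
    refine (norm_add_le _ _).trans ((add_le_add l1 ((norm_add_le _ _).trans (add_le_add l2 k3))).trans
      (le_of_eq ?_))
    rw [hC]
    ring
  have h1 : C * M * ε ≤ M / 2 := by
    have := mul_le_mul_of_nonneg_right hsmall hM0
    linarith
  have h2 := norm_nonneg (x s)
  nlinarith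

end Growth

section Main

open MeasureTheory

lemma intervalIntegrable_of_rpow_abs {T r : ℝ} {b : ℝ → ℝ} (hT : 0 ≤ T) (hr : 1 ≤ r)
    (hb0 : ∀ t ∈ Set.Icc (0 : ℝ) T, 0 ≤ b t)
    (hb : IntervalIntegrable (fun s => |b s| ^ r) volume 0 T) :
    IntervalIntegrable b volume 0 T := by
  have hr0 : 0 < r := by linarith
  rw [intervalIntegrable_iff_integrableOn_Ioc_of_le hT] at hb ⊢
  have hae : ∀ᵐ t ∂volume.restrict (Set.Ioc 0 T), (|b t| ^ r) ^ (1 / r) = b t := by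
    filter_upwards [ae_restrict_mem measurableSet_Ioc] with t ht
    rw [← Real.rpow_mul (abs_nonneg _), mul_one_div_cancel hr0.ne', Real.rpow_one,
      abs_of_nonneg (hb0 t ⟨ht.1.le, ht.2⟩)]
  have hmeas : AEStronglyMeasurable b (volume.restrict (Set.Ioc 0 T)) :=
    ((hb.aestronglyMeasurable.aemeasurable.pow_const (1 / r)).congr hae).aestronglyMeasurable
  have hone : Integrable (fun _ : ℝ => (1 : ℝ)) (volume.restrict (Set.Ioc 0 T)) :=
    integrable_const _
  refine (hone.add hb).mono' hmeas (Filter.Eventually.of_forall fun t => ?_)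
  simp only [Pi.add_apply, Real.norm_eq_abs]
  rcases le_total (|b t|) 1 with h | h
  · have : 0 ≤ |b t| ^ r := by positivity
    linarith
  · have := Real.rpow_le_rpow_of_exponent_le h hr
    rw [Real.rpow_one] at this
    linarith

lemma superAddOn_intervalIntegral {T : ℝ} {b : ℝ → ℝ} (hb0 : ∀ t ∈ Set.Icc (0 : ℝ) T, 0 ≤ b t)
    (hb : IntervalIntegrable b volume 0 T) : SuperAddOn 0 T (fun u v => ∫ r in u..v, b r) := by
  have hii : ∀ u v, 0 ≤ u → u ≤ v → v ≤ T → IntervalIntegrable b volume u v := by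
    intro u v h1 h2 h3
    refine hb.mono_set ?_
    rw [Set.uIcc_of_le h2, Set.uIcc_of_le (h1.trans (h2.trans h3))]
    exact Set.Icc_subset_Icc h1 h3
  refine ⟨fun s t h1 h2 h3 => intervalIntegral.integral_nonneg h2
    fun r hr => hb0 r ⟨h1.trans hr.1, hr.2.trans h3⟩, fun s t u h1 h2 h3 h4 => ?_⟩
  exact (intervalIntegral.integral_add_adjacent_intervals (hii s t h1 h2 (h3.trans h4))
    (hii t u (h1.trans h2) h3 h4)).le

lemma norm_integral_sub_le {F : Type*} [NormedAddCommGroup F] [NormedSpace ℝ F] {t₀ T N : ℝ}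
    (ht₀ : 0 ≤ t₀) {φ : ℝ → F} {b : ℝ → ℝ} (hφ : ContinuousOn φ (Set.Icc t₀ T))
    (hb : IntervalIntegrable b volume 0 T) {u v : ℝ} (hu : t₀ ≤ u) (huv : u ≤ v) (hv : v ≤ T)
    (h : ∀ r, u ≤ r → r ≤ v → ‖φ r‖ ≤ N + b r) :
    ‖(∫ r in t₀..v, φ r) - ∫ r in t₀..u, φ r‖ ≤ N * (v - u) + ∫ r in u..v, b r := by
  have hii : ∀ u v, t₀ ≤ u → u ≤ v → v ≤ T → IntervalIntegrable φ volume u v := by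
    intro u v h1 h2 h3
    refine ContinuousOn.intervalIntegrable (hφ.mono ?_)
    rw [Set.uIcc_of_le h2]
    exact Set.Icc_subset_Icc h1 h3
  have hbi : IntervalIntegrable b volume u v := by
    refine hb.mono_set ?_
    rw [Set.uIcc_of_le huv, Set.uIcc_of_le (ht₀.trans (hu.trans (huv.trans hv)))]
    exact Set.Icc_subset_Icc (ht₀.trans hu) hv
  rw [intervalIntegral.integral_interval_sub_left (hii t₀ v le_rfl (hu.trans huv) hv)
    (hii t₀ u le_rfl hu (huv.trans hv))]
  refine (intervalIntegral.norm_integral_le_of_norm_le huv (Filter.Eventually.of_forall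
    fun r hr => h r hr.1.le hr.2) (intervalIntegrable_const.add hbi)).trans (le_of_eq ?_)
  rw [intervalIntegral.integral_add intervalIntegrable_const hbi, intervalIntegral.integral_const,
    smul_eq_mul, mul_comm]

end Main

set_option maxHeartbeats 1000000 in
/-- Proposition `growth`: under (H1)–(H3), there exist positive constants
`C₁ = C₁(T)`, `C₂ = C₂(T)` (independent of `x0` and `ω`) such that the solution of the Young
equation started at `x0` at time `t0` satisfies
`‖x‖_{q-var,[t0,T]} ≤ C₁ (1+(T-t0)^α)(1+‖x0‖)(1+|||ω|||_{p-var,[t0,T]})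
  exp(C₂ |||ω|||^{p'}_{p-var,[t0,T]})` with `p' = max{p, 1/α}`. -/
theorem stmt14
    {d m : ℕ} (p T : ℝ) (hp1 : 1 < p) (hp2 : p < 2) (hT : 0 < T)
    (f : ℝ → Ed d → Ed d) (g : ℝ → Ed d → (Ed m →L[ℝ] Ed d))
    (hf : ContinuousOn (fun pr : ℝ × Ed d => f pr.1 pr.2) (Set.Icc 0 T ×ˢ Set.univ))
    (hg : ContinuousOn (fun pr : ℝ × Ed d => g pr.1 pr.2) (Set.Icc 0 T ×ˢ Set.univ))
    (Dg : ℝ → Ed d → (Ed d →L[ℝ] Ed m →L[ℝ] Ed d))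
    (hDg : ∀ t ∈ Set.Icc (0:ℝ) T, ∀ x : Ed d, HasFDerivAt (g t) (Dg t x) x)
    (β δ Lg : ℝ) (hβ0 : 0 < β) (hβ1 : β ≤ 1) (hδ0 : 0 < δ) (hδ1 : δ ≤ 1) (hLg : 0 < Lg)
    (h : ℝ → ℝ → ℝ) (hctrl : IsControlOn 0 T h)
    (MN : ℝ → ℝ) (hMN : ∀ N : ℝ, 0 ≤ N → 0 < MN N)
    (H1i : ∀ t ∈ Set.Icc (0:ℝ) T, ∀ x y : Ed d, ‖g t x - g t y‖ ≤ Lg * ‖x - y‖)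
    (H1ii : ∀ N : ℝ, 0 ≤ N → ∀ t ∈ Set.Icc (0:ℝ) T, ∀ x y : Ed d, ‖x‖ ≤ N → ‖y‖ ≤ N →
      ‖Dg t x - Dg t y‖ ≤ MN N * ‖x - y‖ ^ δ)
    (H1iii : ∀ s t : ℝ, 0 ≤ s → s < t → t ≤ T → ∀ x : Ed d,
      ‖g t x - g s x‖ + ‖Dg t x - Dg s x‖ ≤ h s t ^ β)
    (a α : ℝ) (b : ℝ → ℝ) (ha : 0 < a) (hα1 : 1 / 2 ≤ α) (hα2 : α < 1)
    (hbmem : IntervalIntegrable (fun s => |b s| ^ (1 / (1 - α))) MeasureTheory.volume 0 T)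
    (LN : ℝ → ℝ) (hLN : ∀ N : ℝ, 0 ≤ N → 0 < LN N)
    (H2i : ∀ N : ℝ, 0 ≤ N → ∀ t ∈ Set.Icc (0:ℝ) T, ∀ x y : Ed d, ‖x‖ ≤ N → ‖y‖ ≤ N →
      ‖f t x - f t y‖ ≤ LN N * ‖x - y‖)
    (H2ii : ∀ t ∈ Set.Icc (0:ℝ) T, ∀ x : Ed d, ‖f t x‖ ≤ a * ‖x‖ + b t)
    (H3a : p - 1 < δ) (H3b : 1 - 1 / p < β) (H3c : 1 - 1 / p < δ * α)
    (q0 q : ℝ)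
    (hq0a : 1 - 1 / p < 1 / q0)
    (hq0b : 1 / q0 < min (min β (δ * α)) (min (δ / p) (1 / 2)))
    (hqa : 1 / (q0 * δ) ≤ 1 / q) (hqb : 1 / q < min α (1 / p))
    :
    ∃ C1 : ℝ, 0 < C1 ∧ ∃ C2 : ℝ, 0 < C2 ∧
      ∀ t0 : ℝ, 0 ≤ t0 → t0 < T →
      ∀ ω : ℝ → Ed m, ContinuousOn ω (Set.Icc 0 T) → FinitePVar p ω 0 T →
      ∀ (x0 : Ed d) (x : ℝ → Ed d), IsSolutionOn f g ω q t0 T x0 x →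
        pVarNorm q x t0 T ≤
          C1 * (1 + (T - t0) ^ α) * (1 + ‖x0‖) * (1 + pVar p ω t0 T) *
            Real.exp (C2 * pVar p ω t0 T ^ max p (1 / α)) := by
  have hp0 : 0 < p := by linarith
  have hinvp : 0 < 1 / p := by positivity
  have hinvp1 : 1 / p < 1 := by rw [div_lt_one hp0]; exact hp1
  set μ := 1 / q0 with hμdef
  have hμ0 : 0 < μ := by linarith
  have hμβ : μ < β := hq0b.trans_le ((min_le_left _ _).trans (min_le_left _ _))
  have hq00 : 0 < q0 := one_div_pos.1 hμ0
  have hμq : μ ≤ 1 / q := by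
    refine le_trans ?_ hqa
    exact one_div_le_one_div_of_le (by positivity) (mul_le_of_le_one_right hq00.le hδ1)
  have hq0' : 0 < q := one_div_pos.1 (hμ0.trans_le hμq)
  have hqp : 1 / q < 1 / p := hqb.trans_le (min_le_right _ _)
  have hq1 : 1 ≤ q := by
    have : p < q := (one_div_lt_one_div hq0' hp0).1 hqp
    linarith
  obtain ⟨ν, hν1, hν2⟩ := exists_between (max_lt (by linarith : 1 - μ < 1 / p) hqp)
  have hμν : 1 < μ + ν := by linarith [le_max_left (1 - μ) (1 / q)]
  have hqν : 1 / q < ν := (le_max_right _ _).trans_lt hν1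
  have hν0 : 0 < ν := (one_div_pos.2 hq0').trans hqν
  have hνle : ν ≤ 1 := (hν2.trans hinvp1).le
  have hνq : 1 ≤ ν * q := by rw [div_lt_iff₀ hq0'] at hqν; exact hqν.le
  have hb0 : ∀ t ∈ Set.Icc (0 : ℝ) T, 0 ≤ b t := by
    intro t ht
    have := (norm_nonneg _).trans (H2ii t ht 0)
    simpa using this
  have hbi : IntervalIntegrable b MeasureTheory.volume 0 T := by
    refine intervalIntegrable_of_rpow_abs hT.le ?_ hb0 hbmem
    rw [le_div_iff₀ (by linarith)]
    linarith
  obtain ⟨G₀, hG₀⟩ : ∃ C, ∀ t ∈ Set.Icc (0 : ℝ) T, ‖g t 0‖ ≤ C :=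
    isCompact_Icc.exists_bound_of_continuousOn
      (hg.comp (f := fun t => (t, (0 : Ed d))) (by fun_prop) fun t ht => ⟨ht, Set.mem_univ _⟩)
  have hG₀0 : 0 ≤ G₀ := (norm_nonneg _).trans (hG₀ 0 ⟨le_rfl, hT.le⟩)
  have hh := hctrl.superAddOn
  have hbb := superAddOn_intervalIntegral hb0 hbi
  have hH0 : 0 ≤ h 0 T := hh.1 0 T le_rfl hT.le le_rfl
  have hB0 : 0 ≤ ∫ r in (0 : ℝ)..T, b r := hbb.1 0 T le_rfl hT.le le_rfl
  have hK := sewConst_pos hμν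
  set c := h 0 T + (∫ r in (0 : ℝ)..T, b r) + 3 with hc
  have hc3 : 3 ≤ c := by linarith
  set C := c * (a + (Lg + G₀)) + sewConst (μ + ν) * c ^ 2 * (1 + Lg) with hC
  have hC0 : 0 < C := by positivity
  set ε := 1 / (2 * C) with hε
  have hε0 : 0 < ε := by positivity
  have hCε : C * ε ≤ 1 / 2 := by
    rw [hε]
    field_simp
    rfl
  set A := 2 + 2 * c with hA
  have hA2 : 2 ≤ A := by linarith
  set η := min ε (ε ^ p) with hη
  have hη0 : 0 < η := lt_min hε0 (by positivity)
  have hlA : 0 < Real.log A := Real.log_pos (by linarith)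
  refine ⟨Real.exp (Real.log A * (4 * (1 + T) / η + 5)), Real.exp_pos _,
    Real.log A * (4 / η), by positivity, ?_⟩
  intro t0 ht0 ht0T ω hωc hωp x0 x hsol
  obtain ⟨hxc, hxq, hx0, hxeq⟩ := hsol
  have hωc' : ContinuousOn ω (Set.Icc t0 T) := hωc.mono (Set.Icc_subset_Icc ht0 le_rfl)
  have hωp' : FinitePVar p ω t0 T := hωp.restrict ht0 le_rfl
  have hW := hωp'.superAddOn
  set Wtot := sSup (pVarSums p ω t0 T) with hWtot
  have hWtot0 : 0 ≤ Wtot := sSup_pVarSums_nonneg _ _ _ _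
  have hmono : ∀ s t, t0 ≤ s → s ≤ t → t ≤ T → sSup (pVarSums p ω s t) ≤ Wtot :=
    fun s t h1 h2 h3 => hW.mono le_rfl h1 h2 h3 le_rfl
  -- bounds on the integrand along the solution
  have hy : ∀ u v, t0 ≤ u → u ≤ v → v ≤ T →
      ‖g v (x v) - g u (x u)‖ ≤ h u v ^ β + Lg * ‖x v - x u‖ := by
    intro u v hu huv hv
    have hu0 := ht0.trans hu
    rcases huv.eq_or_lt with rfl | hlt
    · rw [sub_self, norm_zero]
      have := hh.1 u u hu0 le_rfl hv
      positivity
    · have e1 := H1iii u v hu0 hlt hv (x u)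
      have e2 := H1i v ⟨hu0.trans huv, hv⟩ (x v) (x u)
      have e3 := norm_add_le (g v (x v) - g v (x u)) (g v (x u) - g u (x u))
      rw [sub_add_sub_cancel] at e3
      linarith [norm_nonneg (Dg v (x u) - Dg u (x u))]
  have hyG : ∀ u, t0 ≤ u → u ≤ T → ‖g u (x u)‖ ≤ (Lg + G₀) * (1 + ‖x u‖) := by
    intro u hu huT
    have hmem : u ∈ Set.Icc (0 : ℝ) T := ⟨ht0.trans hu, huT⟩
    have e1 := H1i u hmem (x u) 0
    have e2 := hG₀ u hmem
    have e3 := norm_add_le (g u (x u) - g u 0) (g u 0)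
    rw [sub_add_cancel] at e3
    rw [sub_zero] at e1
    have := mul_nonneg hG₀0 (norm_nonneg (x u))
    linarith
  have hfc : ContinuousOn (fun s => f s (x s)) (Set.Icc t0 T) :=
    hf.comp (f := fun t => (t, x t)) (continuousOn_id.prodMk hxc)
      fun t ht => ⟨⟨ht0.trans ht.1, ht.2⟩, Set.mem_univ _⟩
  -- the Young integral along the solution
  have hωW : ∀ u v, t0 ≤ u → u ≤ v → v ≤ T →
      ‖ω v - ω u‖ ≤ 1 * sSup (pVarSums p ω u v) ^ (1 / p) := by
    intro u v hu huv hv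
    rw [one_mul]
    exact hωp'.norm_le hp0 hu huv hv
  have hω_norm : ∀ s t, t0 ≤ s → s ≤ t → t ≤ T → ∀ Z e, 0 < Z → 0 ≤ e →
      (∀ u v, s ≤ u → u ≤ v → v ≤ t → ‖ω v - ω u‖ ≤ e * sSup (pVarSums p ω u v) ^ ν) →
      e * Z ^ ν ≤ ε →
      ∀ u v, s ≤ u → u ≤ v → v ≤ t →
        ‖ω v - ω u‖ ≤ ε * (sSup (pVarSums p ω u v) / Z) ^ ν := by
    intro s t _ _ _ Z e hZ _ hb' hle u v hu huv hv
    have hnn := sSup_pVarSums_nonneg p ω u v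
    refine (hb' u v hu huv hv).trans ?_
    have h1 : e * sSup (pVarSums p ω u v) ^ ν =
        e * Z ^ ν * (sSup (pVarSums p ω u v) / Z) ^ ν := by
      rw [mul_assoc, ← Real.mul_rpow hZ.le (by positivity), mul_div_cancel₀ _ hZ.ne']
    rw [h1]
    gcongr
  have hW1 : (0 : ℝ) < 1 + Wtot := by positivity
  have hsub1 : ∀ Z : ℝ, 0 < Z → ∀ s t, t0 ≤ s → s ≤ t → t ≤ T → sSup (pVarSums p ω s t) ≤ Z →
      ∀ u v, s ≤ u → u ≤ v → v ≤ t →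
        ‖ω v - ω u‖ ≤ Z ^ (1 / p) * (sSup (pVarSums p ω u v) / Z) ^ ν := by
    intro Z hZ s t hs hst ht hle u v hu huv hv
    have hnn := sSup_pVarSums_nonneg p ω u v
    have e1 := hωp'.norm_le hp0 (hs.trans hu) huv (hv.trans ht)
    have e2 : sSup (pVarSums p ω u v) ≤ Z :=
      ((hW.restrict hs ht).mono le_rfl hu huv hv le_rfl).trans hle
    have e3 : sSup (pVarSums p ω u v) ^ (1 / p) =
        Z ^ (1 / p) * (sSup (pVarSums p ω u v) / Z) ^ (1 / p) := by
      rw [← Real.mul_rpow hZ.le (by positivity), mul_div_cancel₀ _ hZ.ne']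
    rw [e3] at e1
    refine e1.trans ?_
    have e4 : (sSup (pVarSums p ω u v) / Z) ^ (1 / p) ≤ (sSup (pVarSums p ω u v) / Z) ^ ν :=
      Real.rpow_le_rpow_of_exponent_ge_of_imp (by positivity) ((div_le_one hZ).2 e2) hν2.le
        (fun _ h' => absurd h' hinvp.ne')
    gcongr
  obtain ⟨I, hIeq, hI⟩ : ∃ I : ℝ → Ed d,
      (∀ t ∈ Set.Icc t0 T, youngIntegral (fun s => g s (x s)) ω t0 t = I t - I t0) ∧
      ∀ u v, t0 ≤ u → u ≤ v → v ≤ T → ∀ (w' : ℝ → ℝ → ℝ) (μ' ν' D₁' D₂' : ℝ),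
      SuperAddOn u v w' → 0 < μ' → 0 < ν' → 1 < μ' + ν' → 0 ≤ D₁' → 0 ≤ D₂' →
      (∀ s t, u ≤ s → s ≤ t → t ≤ v → ‖g t (x t) - g s (x s)‖ ≤ D₁' * w' s t ^ μ') →
      (∀ s t, u ≤ s → s ≤ t → t ≤ v → ‖ω t - ω s‖ ≤ D₂' * w' s t ^ ν') →
      ‖I v - I u - g u (x u) (ω v - ω u)‖ ≤
        sewConst (μ' + ν') * (D₁' * D₂') * w' u v ^ (μ' + ν') := by
    set E₀ := max (T - t0) ((1 + Wtot) ^ (1 / p)) with hE₀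
    have hE₀0 : 0 < E₀ := lt_max_of_lt_left (by linarith)
    obtain ⟨w, hw, -, hwp⟩ := exists_control (s := t0) (t := T) (y := fun s => g s (x s)) (ε := E₀)
      ht0T.le hq1 hμ0 hμβ.le hβ1 hμq hν0 hνle hLg.le hE₀0 hxq (hh.restrict ht0 le_rfl)
      (hbb.restrict ht0 le_rfl) (hW.div_const hW1.le) (hh.mono le_rfl ht0 ht0T.le le_rfl le_rfl)
      (hbb.mono le_rfl ht0 ht0T.le le_rfl le_rfl)
      ((div_le_one hW1).2 (by linarith)) (le_max_left _ _)
      (fun u v hu huv hv => (hsub1 (1 + Wtot) hW1 t0 T le_rfl ht0T.le le_rfl (by linarith)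
        u v hu huv hv).trans (by
          have := sSup_pVarSums_nonneg p ω u v
          gcongr
          exact le_max_right _ _)) hy
    have hR := pVar_nonneg q x t0 T
    exact exists_youngIntegral_eq ht0T.le hωc' hw hμ0 hν0 hμν (by positivity) (by positivity)
      (fun s t h1 h2 h3 => (hwp s t h1 h2 h3).2.2.2) (fun s t h1 h2 h3 => (hwp s t h1 h2 h3).2.2.1)
  have hloc : ∀ s t, t0 ≤ s → s ≤ t → t ≤ T → t - s ≤ ε → ∀ w₀ : ℝ → ℝ → ℝ, SuperAddOn s t w₀ →
      w₀ s t ≤ 1 →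
      (∀ u v, s ≤ u → u ≤ v → v ≤ t → ‖ω v - ω u‖ ≤ ε * w₀ u v ^ ν) →
      1 + ‖x s‖ + pVar q x s t ≤ A * (1 + ‖x s‖) := by
    intro s t hs hst ht hd w₀ hw₀ hw₀1 hω'
    refine local_growth (Φ := fun t => ∫ r in t0..t, f r (x r)) (I := I)
      (y := fun s => g s (x s)) hst hq1 hμ0 hμβ.le hβ1 hμq hν0
      hνle hμν hνq hLg.le hε0 (by positivity : 0 ≤ Lg + G₀) ha.le (hxq.restrict hs ht)
      (hh.restrict (ht0.trans hs) ht) (hbb.restrict (ht0.trans hs) ht) hw₀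
      (hh.mono le_rfl (ht0.trans hs) hst ht le_rfl) (hbb.mono le_rfl (ht0.trans hs) hst ht le_rfl)
      hw₀1 hd hω' (fun u v h1 h2 h3 => hy u v (hs.trans h1) h2 (h3.trans ht))
      (fun u h1 h2 => hyG u (hs.trans h1) (h2.trans ht)) ?_ ?_
      (fun u v h1 h2 h3 => hI u v (hs.trans h1) h2 (h3.trans ht)) hCε
    · intro u v h1 h2 h3
      have hu : u ∈ Set.Icc t0 T := ⟨hs.trans h1, h2.trans (h3.trans ht)⟩
      have hv : v ∈ Set.Icc t0 T := ⟨hs.trans (h1.trans h2), h3.trans ht⟩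
      rw [hxeq u hu, hxeq v hv, hIeq u hu, hIeq v hv]
      abel
    · intro M hM u v h1 h2 h3
      refine norm_integral_sub_le ht0 hfc hbi (hs.trans h1) h2 (h3.trans ht) fun r h4 h5 => ?_
      have hr1 : s ≤ r := h1.trans h4
      have hr2 : r ≤ t := h5.trans h3
      refine (H2ii r ⟨ht0.trans (hs.trans hr1), hr2.trans ht⟩ (x r)).trans ?_
      gcongr
      exact hM r hr1 hr2
  -- intervals of small variation, and short intervals
  set V : ℝ → ℝ → ℝ := fun s t => sSup (pVarSums p ω s t) + (t - s) with hV
  have hVs : SuperAddOn t0 T V := hW.add (superAddOn_sub t0 T)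
  have hloc1 : ∀ s t, t0 ≤ s → s ≤ t → t ≤ T → V s t ≤ η →
      1 + ‖x s‖ + pVar q x s t ≤ A * (1 + ‖x s‖) := by
    intro s t hs hst ht hle
    have hnn := sSup_pVarSums_nonneg p ω s t
    simp only [hV] at hle
    have hle' : sSup (pVarSums p ω s t) ≤ η := by linarith
    refine hloc s t hs hst ht (by linarith [min_le_left ε (ε ^ p)]) _
      ((hW.restrict hs ht).div_const hη0.le) ((div_le_one hη0).2 hle') ?_
    intro u v hu huv hv
    refine (hsub1 η hη0 s t hs hst ht hle' u v hu huv hv).trans ?_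
    have h1 : η ^ (1 / p) ≤ ε := by
      have := Real.rpow_le_rpow hη0.le (min_le_right ε (ε ^ p)) hinvp.le
      rwa [← Real.rpow_mul hε0.le, mul_one_div_cancel hp0.ne', Real.rpow_one] at this
    have := sSup_pVarSums_nonneg p ω u v
    gcongr
  obtain ⟨ρ, hρ, hloc2⟩ : ∃ ρ > 0, ∀ s t, t0 ≤ s → s ≤ t → t ≤ T → t - s ≤ ρ →
      1 + ‖x s‖ + pVar q x s t ≤ A * (1 + ‖x s‖) := by
    set κ := ν * p with hκ
    have hκ1 : κ < 1 := by rwa [lt_div_iff₀ hp0] at hν2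
    have hκ0 : 0 < κ := by positivity
    have hκν : 1 / p * κ = ν := by rw [hκ]; field_simp
    set e := ε / (1 + Wtot) ^ ν with he
    have he0 : 0 < e := by positivity
    obtain ⟨ρ, hρ, hosc⟩ := hωc'.exists_osc_le (o := e ^ (1 / (1 - κ))) (by positivity)
    have heq : (e ^ (1 / (1 - κ))) ^ (1 - κ) = e := by
      rw [← Real.rpow_mul he0.le, one_div_mul_cancel (by linarith), Real.rpow_one]
    refine ⟨min ρ ε, lt_min hρ hε0, fun s t hs hst ht hd => ?_⟩
    refine hloc s t hs hst ht (hd.trans (min_le_right _ _)) _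
      ((hW.restrict hs ht).div_const hW1.le)
      ((div_le_one hW1).2 (by linarith [hmono s t hs hst ht])) ?_
    refine hω_norm s t hs hst ht (1 + Wtot) e hW1 he0.le ?_ (by rw [he]; field_simp; rfl)
    intro u v hu huv hv
    have := le_interpolate (norm_nonneg _) zero_le_one (sSup_pVarSums_nonneg p ω u v) hκ0.le hκ1.le
      (hosc u v (hs.trans hu) huv (hv.trans ht) (by linarith [min_le_left ρ ε]))
      (hωW u v (hs.trans hu) huv (hv.trans ht))
    rwa [heq, Real.one_rpow, mul_one, hκν] at this
  have hP0 := pVar_nonneg p ω t0 T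
  have hPp := pVar_rpow hp0 ω t0 T
  set P := pVar p ω t0 T with hP
  have hV0 : 0 ≤ V t0 T := hVs.1 t0 T le_rfl ht0T.le le_rfl
  have hceil : V t0 T ≤ (⌈V t0 T / η⌉₊ + 1) * η := by
    have := Nat.le_ceil (V t0 T / η)
    rw [div_le_iff₀ hη0] at this
    linarith
  have hfin := pVar_growth_of_local hq1 hxq hVs hη0 hρ hA2 hloc1 hloc2 ⌈V t0 T / η⌉₊ t0 le_rfl
    ht0T.le hceil
  have hVle : V t0 T ≤ P ^ max p (1 / α) + (1 + T) := by
    have h1 : P ^ p ≤ 1 + P ^ max p (1 / α) := by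
      have hnn : 0 ≤ P ^ max p (1 / α) := by positivity
      rcases le_total P 1 with h' | h'
      · have := Real.rpow_le_one hP0 h' hp0.le
        linarith
      · have := Real.rpow_le_rpow_of_exponent_le h' (le_max_left p (1 / α))
        linarith
    simp only [hV]
    rw [← hPp]
    linarith
  have hpow : A ^ (4 * ⌈V t0 T / η⌉₊ + 1) ≤
      Real.exp (Real.log A * (4 * (1 + T) / η + 5)) *
        Real.exp (Real.log A * (4 / η) * P ^ max p (1 / α)) := by
    rw [← Real.exp_add, ← Real.rpow_natCast, Real.rpow_def_of_pos (by linarith)]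
    refine Real.exp_le_exp.2 ?_
    have h1 := (Nat.ceil_lt_add_one (div_nonneg hV0 hη0.le)).le
    have h2 : V t0 T / η ≤ (P ^ max p (1 / α) + (1 + T)) / η := by gcongr
    have h3 : ((4 * ⌈V t0 T / η⌉₊ + 1 : ℕ) : ℝ) ≤
        4 * ((P ^ max p (1 / α) + (1 + T)) / η) + 5 := by
      push_cast
      linarith
    refine (mul_le_mul_of_nonneg_left h3 hlA.le).trans (le_of_eq ?_)
    ring
  have hx0n := norm_nonneg x0
  have hTα : 0 ≤ (T - t0) ^ α := Real.rpow_nonneg (by linarith) _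
  rw [hx0] at hfin
  unfold pVarNorm
  rw [hx0]
  set X₁ := Real.exp (Real.log A * (4 * (1 + T) / η + 5))
  set X₂ := Real.exp (Real.log A * (4 / η) * P ^ max p (1 / α))
  have hX₁ : 0 < X₁ := Real.exp_pos _
  have hX₂ : 0 < X₂ := Real.exp_pos _
  calc ‖x0‖ + pVar q x t0 T ≤ A ^ (4 * ⌈V t0 T / η⌉₊ + 1) * (1 + ‖x0‖) := by linarith
    _ ≤ X₁ * X₂ * (1 + ‖x0‖) := by gcongr
    _ = X₁ * 1 * (1 + ‖x0‖) * 1 * X₂ := by ring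
    _ ≤ X₁ * (1 + (T - t0) ^ α) * (1 + ‖x0‖) * (1 + P) * X₂ := by
        gcongr
        · linarith
        · linarith
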